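/- Let K be an algebraically closed field of characteristic 0. Given matrices B_1,…,B_4 ∈ M_{2×3}(K), C_1,…,C_4 ∈ M_{2×4}(K), D_1,…,D_4 ∈ M_{3×4}(K) and vectors f_1,…,f_4 ∈ K^4, for i = 1,…,4 let A_i be the 10×10 matrix with rows and columns partitioned into blocks of sizes 2, 3, 4, 1, whose only possibly nonzero blocks are the (1,2) block B_i, the (1,3) block C_i, the (2,3) block D_i and the (3,4) block f_i. Assume: A_1,…,A_4 pairwise commute; f_1,…,f_4 are linearly independent; the images of D_1,…,D_4 together span K^3; the images of B_1,…,B_4 together span K^2; and the common kernel ⋂_{i=1}^4 ker A_i has dimension 2. Then (A_1,…,A_4) lies in the Zariski closure of the set of simultaneously diagonalizable quadruples of 10×10 matrices. (This is the matrix form of: every local algebra with Hilbert function (1,4,3,2) and socle dimension 2 is smoothable.) -/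

import Mathlib

open Matrix

/-- A tuple of square matrices is simultaneously diagonalizable. -/
def SimDiag {K : Type*} [Field K] {N ι : Type*} [Fintype ι] [DecidableEq ι]
    (A : N → Matrix ι ι K) : Prop :=
  ∃ P : Matrix ι ι K, IsUnit P ∧ ∀ i, (P⁻¹ * A i * P).IsDiag

/-- A tuple of square matrices lies in the Zariski closure of the set of simultaneously
diagonalizable tuples (the principal component): every polynomial in the matrix entries
vanishing on all simultaneously diagonalizable tuples vanishes at the given tuple. -/
def InSimDiagClosure {K : Type*} [Field K] {N ι : Type*} [Fintype ι] [DecidableEq ι]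
    (A : N → Matrix ι ι K) : Prop :=
  ∀ Φ : MvPolynomial (N × ι × ι) K,
    (∀ B : N → Matrix ι ι K, SimDiag B →
      MvPolynomial.eval (fun x => B x.1 x.2.1 x.2.2) Φ = 0) →
    MvPolynomial.eval (fun x => A x.1 x.2.1 x.2.2) Φ = 0

/-- The 10×10 block matrix with blocks of sizes 2, 3, 4, 1, whose only nonzero blocks are
the (1,2) block `B`, the (1,3) block `C`, the (2,3) block `D` and the (3,4) block `f`. -/
def blockMat1432 {K : Type*} [Field K] (B : Matrix (Fin 2) (Fin 3) K)
    (C : Matrix (Fin 2) (Fin 4) K) (D : Matrix (Fin 3) (Fin 4) K) (f : Fin 4 → K) :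
    Matrix (Fin 2 ⊕ (Fin 3 ⊕ (Fin 4 ⊕ Fin 1))) (Fin 2 ⊕ (Fin 3 ⊕ (Fin 4 ⊕ Fin 1))) K :=
  Matrix.of fun p q =>
    match p, q with
    | Sum.inl a, Sum.inr (Sum.inl a') => B a a'
    | Sum.inl a, Sum.inr (Sum.inr (Sum.inl a')) => C a a'
    | Sum.inr (Sum.inl a), Sum.inr (Sum.inr (Sum.inl a')) => D a a'
    | Sum.inr (Sum.inr (Sum.inl a)), Sum.inr (Sum.inr (Sum.inr _)) => f a
    | _, _ => 0

/-- A function of the coordinates `x : σ → K` that is given by a polynomial. -/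
@[fun_prop]
def PolyFun {K σ : Type*} [Field K] (f : (σ → K) → K) : Prop :=
  ∃ p : MvPolynomial σ K, ∀ x, f x = MvPolynomial.eval x p

namespace PolyFun

variable {K σ : Type*} [Field K] {f g : (σ → K) → K}

@[fun_prop]
theorem const (c : K) : PolyFun (fun _ : σ → K => c) :=
  ⟨MvPolynomial.C c, fun _ => by simp⟩

@[fun_prop]
theorem coord (i : σ) : PolyFun (fun x : σ → K => x i) :=
  ⟨MvPolynomial.X i, fun _ => by simp⟩

@[fun_prop]
theorem add (hf : PolyFun f) (hg : PolyFun g) : PolyFun (fun x => f x + g x) := by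
  obtain ⟨p, hp⟩ := hf
  obtain ⟨q, hq⟩ := hg
  exact ⟨p + q, fun x => by simp [hp, hq]⟩

@[fun_prop]
theorem mul (hf : PolyFun f) (hg : PolyFun g) : PolyFun (fun x => f x * g x) := by
  obtain ⟨p, hp⟩ := hf
  obtain ⟨q, hq⟩ := hg
  exact ⟨p * q, fun x => by simp [hp, hq]⟩

@[fun_prop]
theorem neg (hf : PolyFun f) : PolyFun (fun x => -f x) := by
  obtain ⟨p, hp⟩ := hf
  exact ⟨-p, fun x => by simp [hp]⟩

@[fun_prop]
theorem sub (hf : PolyFun f) (hg : PolyFun g) : PolyFun (fun x => f x - g x) := by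
  obtain ⟨p, hp⟩ := hf
  obtain ⟨q, hq⟩ := hg
  exact ⟨p - q, fun x => by simp [hp, hq]⟩

@[fun_prop]
theorem pow (hf : PolyFun f) (n : ℕ) : PolyFun (fun x => f x ^ n) := by
  obtain ⟨p, hp⟩ := hf
  exact ⟨p ^ n, fun x => by simp [hp]⟩

@[fun_prop]
theorem sum {τ : Type*} (s : Finset τ) {F : τ → (σ → K) → K} (hF : ∀ i, PolyFun (F i)) :
    PolyFun (fun x => ∑ i ∈ s, F i x) := by
  choose p hp using hF
  exact ⟨∑ i ∈ s, p i, fun x => by simp [hp]⟩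

theorem eval_comp {τ : Type*} {F : (σ → K) → τ → K} (hF : ∀ i, PolyFun (fun x => F x i))
    (Φ : MvPolynomial τ K) : PolyFun (fun x => MvPolynomial.eval (F x) Φ) := by
  choose p hp using hF
  refine ⟨MvPolynomial.bind₁ p Φ, fun x => ?_⟩
  change MvPolynomial.eval (F x) Φ = MvPolynomial.eval x (MvPolynomial.bind₁ p Φ)
  rw [← MvPolynomial.coe_aeval_eq_eval x, RingHom.coe_coe, MvPolynomial.aeval_bind₁,
    ← MvPolynomial.coe_aeval_eq_eval, RingHom.coe_coe]
  congr 2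
  funext y
  exact (hp y x).trans (by simp)

end PolyFun

section Closure

variable {K : Type*} [Field K] {N N' ι ι' : Type*} [Fintype ι] [DecidableEq ι]
  [Fintype ι'] [DecidableEq ι']

theorem SimDiag.inSimDiagClosure {A : N → Matrix ι ι K} (h : SimDiag A) : InSimDiagClosure A :=
  fun _ hΦ => hΦ A h

/-- A polynomial map sending simultaneously diagonalizable tuples into the closure preserves
the closure. -/
theorem InSimDiagClosure.map {A : N → Matrix ι ι K} (hA : InSimDiagClosure A)
    (F : (N × ι × ι → K) → N' → Matrix ι' ι' K)
    (hF : ∀ i a b, PolyFun (fun x => F x i a b))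
    (hd : ∀ B : N → Matrix ι ι K, SimDiag B →
      InSimDiagClosure (F fun x => B x.1 x.2.1 x.2.2)) :
    InSimDiagClosure (F fun x => A x.1 x.2.1 x.2.2) := by
  intro Φ hΦ
  obtain ⟨p, key⟩ := PolyFun.eval_comp
    (F := fun x (y : N' × ι' × ι') => F x y.1 y.2.1 y.2.2) (fun y => hF y.1 y.2.1 y.2.2) Φ
  beta_reduce at key
  rw [key]
  refine hA _ fun B hB => ?_
  rw [← key]
  exact hd B hB Φ hΦ

/-- In a polynomial family of tuples, if the generic member lies in the closure,
then all members do. -/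
theorem InSimDiagClosure.of_generic [Infinite K] {σ : Type*}
    (A : (σ → K) → N → Matrix ι ι K)
    (hA : ∀ i a b, PolyFun (fun x => A x i a b)) (h : (σ → K) → K) (hh : PolyFun h)
    (x₁ : σ → K) (h₁ : h x₁ ≠ 0) (hgen : ∀ x, h x ≠ 0 → InSimDiagClosure (A x)) (x : σ → K) :
    InSimDiagClosure (A x) := by
  intro Φ hΦ
  obtain ⟨q, hq⟩ := hh
  obtain ⟨p, key⟩ := PolyFun.eval_comp
    (F := fun x (y : N × ι × ι) => A x y.1 y.2.1 y.2.2) (fun y => hA y.1 y.2.1 y.2.2) Φ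
  beta_reduce at key
  have hz : q * p = 0 := by
    apply MvPolynomial.funext
    intro x
    rw [map_mul, map_zero, ← key, ← hq]
    by_cases hx : h x = 0
    · rw [hx, zero_mul]
    · rw [hgen x hx Φ hΦ, mul_zero]
  rcases mul_eq_zero.mp hz with h0 | h0
  · exact absurd (by rw [hq, h0, map_zero]) h₁
  · rw [key, h0, map_zero]

theorem SimDiag.conj {A A' : N → Matrix ι ι K} (h : SimDiag A) (g : Matrix ι ι K)
    (hg : IsUnit g) (hA : ∀ i, A' i = g * A i * g⁻¹) : SimDiag A' := by
  obtain ⟨P, hP, hd⟩ := h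
  refine ⟨g * P, hg.mul hP, fun i => ?_⟩
  have hg' : g⁻¹ * g = 1 := Matrix.nonsing_inv_mul g ((Matrix.isUnit_iff_isUnit_det g).mp hg)
  have : (g * P)⁻¹ * A' i * (g * P) = P⁻¹ * A i * P := by
    rw [hA, Matrix.mul_inv_rev]
    simp only [Matrix.mul_assoc]
    rw [← Matrix.mul_assoc g⁻¹ g, hg', Matrix.one_mul, ← Matrix.mul_assoc g⁻¹ g, hg',
      Matrix.one_mul]
  rw [this]
  exact hd i

theorem InSimDiagClosure.conj {A A' : N → Matrix ι ι K} (h : InSimDiagClosure A)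
    (g : Matrix ι ι K) (hg : IsUnit g) (hA : ∀ i, A' i * g = g * A i) :
    InSimDiagClosure A' := by
  have hg' : g * g⁻¹ = 1 := Matrix.mul_nonsing_inv g ((Matrix.isUnit_iff_isUnit_det g).mp hg)
  have e : A' = fun i => g * A i * g⁻¹ := by
    funext i
    rw [← hA, Matrix.mul_assoc, hg', Matrix.mul_one]
  rw [e]
  refine h.map (fun x i => g * (Matrix.of fun a b => x (i, a, b)) * g⁻¹) (fun i a b => ?_)
    fun B hB => (hB.conj g hg fun i => rfl).inSimDiagClosure
  simp only [Matrix.mul_apply, Matrix.of_apply]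
  fun_prop

/-- A tuple is simultaneously diagonalizable if its joint eigenvectors span. -/
theorem simDiag_of_span_eq_top {A : N → Matrix ι ι K} (W : Set (ι → K))
    (hW : ∀ w ∈ W, ∀ i, ∃ μ : K, A i *ᵥ w = μ • w) (hs : Submodule.span K W = ⊤) :
    SimDiag A := by
  classical
  let b₀ := Module.Basis.ofSpan hs.ge
  let e := b₀.indexEquiv (Pi.basisFun K ι)
  let b := b₀.reindex e
  have hb : ∀ j, b j ∈ W := fun j => by
    apply Module.Basis.ofSpan_subset hs.ge
    exact ⟨e.symm j, by simp [b, b₀]⟩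
  let P : Matrix ι ι K := (Pi.basisFun K ι).toMatrix b
  have hPu : IsUnit P := by
    have := (Pi.basisFun K ι).invertibleToMatrix b
    exact isUnit_of_invertible P
  refine ⟨P, hPu, fun i => ?_⟩
  choose μ hμ using fun j => hW (b j) (hb j) i
  have h1 : A i * P = P * Matrix.diagonal μ := by
    ext a j
    have := congrFun (hμ j) a
    simp only [Matrix.mulVec, dotProduct, Pi.smul_apply, smul_eq_mul] at this
    simp [Matrix.mul_apply, P, Module.Basis.toMatrix_apply, this, Matrix.diagonal_apply, mul_comm]
  rw [Matrix.mul_assoc, h1, ← Matrix.mul_assoc,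
    Matrix.nonsing_inv_mul P ((Matrix.isUnit_iff_isUnit_det P).mp hPu), Matrix.one_mul]
  exact Matrix.isDiag_diagonal μ

end Closure

section Smoothing

variable {K : Type*} [Field K]

/-- The index set of the standard basis: socle part, quadrics, linear forms, and the unit. -/
abbrev Idx : Type := Fin 2 ⊕ (Fin 3 ⊕ (Fin 4 ⊕ Fin 1))

/-- The socle basis vectors. -/
def eS (K : Type*) [Field K] (j : Fin 2) : Idx → K := Pi.single (Sum.inl j) 1

/-- The quadric basis vectors. -/
def eQ (K : Type*) [Field K] (k : Fin 3) : Idx → K := Pi.single (Sum.inr (Sum.inl k)) 1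

/-- The linear basis vectors. -/
def eV (K : Type*) [Field K] (b : Fin 4) : Idx → K :=
  Pi.single (Sum.inr (Sum.inr (Sum.inl b))) 1

/-- The unit basis vector. -/
def eU (K : Type*) [Field K] : Idx → K := Pi.single (Sum.inr (Sum.inr (Sum.inr 0))) 1

theorem mem_of_basis_mem (M : Submodule K (Idx → K)) (hS : ∀ j, eS K j ∈ M) (hQ : ∀ k, eQ K k ∈ M)
    (hV : ∀ b, eV K b ∈ M) (hU : eU K ∈ M) : M = ⊤ := by
  rw [eq_top_iff, ← (Pi.basisFun K Idx).span_eq, Submodule.span_le]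
  rintro _ ⟨p, rfl⟩
  rw [Pi.basisFun_apply]
  rcases p with j | k | b | o
  · exact hS j
  · exact hQ k
  · exact hV b
  · rw [Subsingleton.elim o 0]; exact hU

/-- The deformed multiplication by the `k`-th square root direction. -/
def smoothX (t : K) (v : Fin 3 → Fin 2 → K) (σ : Fin 2 → K) (k : Fin 3) : Matrix Idx Idx K :=
  Matrix.of fun p q => match p, q with
    | Sum.inl i, Sum.inl j => if i = j then -t ^ 3 * v k j else 0
    | Sum.inl j, Sum.inr (Sum.inl l) => if l = k then v k j else 0
    | Sum.inr (Sum.inr (Sum.inl b)), Sum.inr (Sum.inl l) =>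
      if l = k ∧ b = k.castSucc then t ^ 2 else 0
    | Sum.inl j, Sum.inr (Sum.inr (Sum.inl b)) =>
      t * v k j * ![v 0 j, v 1 j, v 2 j, t * σ j] b
    | Sum.inr (Sum.inl l), Sum.inr (Sum.inr (Sum.inl b)) =>
      if l = k ∧ b = k.castSucc then 1 else 0
    | Sum.inr (Sum.inr (Sum.inl b)), Sum.inr (Sum.inr (Sum.inr _)) =>
      if b = k.castSucc then 1 else 0
    | _, _ => 0

/-- The deformed multiplication by the remaining linear form. -/
def smoothZ (t : K) (v : Fin 3 → Fin 2 → K) (σ : Fin 2 → K) : Matrix Idx Idx K :=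
  Matrix.of fun p q => match p, q with
    | Sum.inl i, Sum.inl j => if i = j then -t ^ 4 * σ j else 0
    | Sum.inl j, Sum.inr (Sum.inr (Sum.inl b)) =>
      t ^ 2 * σ j * ![v 0 j, v 1 j, v 2 j, t * σ j] b + if b = 3 then σ j else 0
    | Sum.inr (Sum.inr (Sum.inl a)), Sum.inr (Sum.inr (Sum.inl b)) =>
      if a = 3 ∧ b = 3 then t else 0
    | Sum.inr (Sum.inr (Sum.inl b)), Sum.inr (Sum.inr (Sum.inr _)) =>
      if b = 3 then 1 else 0
    | _, _ => 0

section Columns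

variable (t : K) (v : Fin 3 → Fin 2 → K) (σ : Fin 2 → K) (k : Fin 3)

theorem smoothX_eS (j : Fin 2) : smoothX t v σ k *ᵥ eS K j = (-t ^ 3 * v k j) • eS K j := by
  rw [eS, Matrix.mulVec_single_one]
  ext p
  rcases p with i | l | b | o <;> simp [smoothX, Pi.single_apply]

theorem smoothX_eQ (l : Fin 3) : smoothX t v σ k *ᵥ eQ K l =
    if l = k then t ^ 2 • eV K k.castSucc + (v k 0 • eS K 0 + v k 1 • eS K 1) else 0 := by
  rw [eQ, Matrix.mulVec_single_one]
  ext p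
  split_ifs with h
  · rcases p with i | l | b | o <;> simp [smoothX, Pi.single_apply, eS, eV, h]
    fin_cases i <;> simp
  · rcases p with i | l | b | o <;> simp [smoothX, h]

theorem smoothX_eV (b : Fin 4) : smoothX t v σ k *ᵥ eV K b =
    (if b = k.castSucc then eQ K k else 0) +
      ((t * v k 0 * ![v 0 0, v 1 0, v 2 0, t * σ 0] b) • eS K 0 +
      (t * v k 1 * ![v 0 1, v 1 1, v 2 1, t * σ 1] b) • eS K 1) := by
  rw [eV, Matrix.mulVec_single_one]
  ext p
  split_ifs with h
  · rcases p with i | l | b | o <;> simp [smoothX, Pi.single_apply, eS, eQ, h]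
    fin_cases i <;> simp
  · rcases p with i | l | b | o <;> simp [smoothX, eS, h]
    fin_cases i <;> simp

theorem smoothX_eU : smoothX t v σ k *ᵥ eU K = eV K k.castSucc := by
  rw [eU, Matrix.mulVec_single_one]
  ext p
  rcases p with i | l | b | o <;> simp [smoothX, Pi.single_apply, eV]

theorem smoothZ_eS (j : Fin 2) : smoothZ t v σ *ᵥ eS K j = (-t ^ 4 * σ j) • eS K j := by
  rw [eS, Matrix.mulVec_single_one]
  ext p
  rcases p with i | l | b | o <;> simp [smoothZ, Pi.single_apply]

theorem smoothZ_eQ (l : Fin 3) : smoothZ t v σ *ᵥ eQ K l = 0 := by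
  rw [eQ, Matrix.mulVec_single_one]
  ext p
  rcases p with i | l | b | o <;> simp [smoothZ]

theorem smoothZ_eV (b : Fin 4) : smoothZ t v σ *ᵥ eV K b =
    (if b = 3 then t • eV K 3 + (σ 0 • eS K 0 + σ 1 • eS K 1) else 0) +
      ((t ^ 2 * σ 0 * ![v 0 0, v 1 0, v 2 0, t * σ 0] b) • eS K 0 +
      (t ^ 2 * σ 1 * ![v 0 1, v 1 1, v 2 1, t * σ 1] b) • eS K 1) := by
  rw [eV, Matrix.mulVec_single_one]
  ext p
  split_ifs with h
  · rcases p with i | l | b | o <;> simp [smoothZ, Pi.single_apply, eS, eV, h]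
    fin_cases i <;> simp [add_comm]
  · rcases p with i | l | b | o <;> simp [smoothZ, eS, h]
    fin_cases i <;> simp

theorem smoothZ_eU : smoothZ t v σ *ᵥ eU K = eV K 3 := by
  rw [eU, Matrix.mulVec_single_one]
  ext p
  rcases p with i | l | b | o <;> simp [smoothZ, Pi.single_apply, eV]

end Columns

/-- The joint eigenvectors of the deformed multiplications. -/
def smoothEigen (t : K) (v : Fin 3 → Fin 2 → K) (σ : Fin 2 → K) :
    (Fin 2 ⊕ Fin 3) ⊕ (Fin 3 ⊕ Fin 2) → Idx → K
  | Sum.inl (Sum.inl j) => eS K j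
  | Sum.inl (Sum.inr k) =>
    t • eQ K k + (t ^ 2 • eV K k.castSucc + (v k 0 • eS K 0 + v k 1 • eS K 1))
  | Sum.inr (Sum.inl k) =>
    t • eQ K k - (t ^ 2 • eV K k.castSucc + (v k 0 • eS K 0 + v k 1 • eS K 1))
  | Sum.inr (Sum.inr 0) => t • eV K 3 + (σ 0 • eS K 0 + σ 1 • eS K 1)
  | Sum.inr (Sum.inr 1) => t ^ 5 • eU K - (eS K 0 + eS K 1) - t ^ 3 • (eQ K 0 + eQ K 1 + eQ K 2)
      - t ^ 4 • eV K 3 - t ^ 3 • (σ 0 • eS K 0 + σ 1 • eS K 1)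

theorem smoothX_eigen (t : K) (v : Fin 3 → Fin 2 → K) (σ : Fin 2 → K) (k : Fin 3)
    (r : (Fin 2 ⊕ Fin 3) ⊕ (Fin 3 ⊕ Fin 2)) :
    ∃ μ : K, smoothX t v σ k *ᵥ smoothEigen t v σ r = μ • smoothEigen t v σ r := by
  rcases r with (j | l) | (l | o)
  · exact ⟨_, smoothX_eS ..⟩
  · refine ⟨if l = k then t else 0, ?_⟩
    simp only [smoothEigen, mulVec_add, mulVec_smul, smoothX_eS, smoothX_eQ, smoothX_eV]
    by_cases h : l = k
    · subst h
      fin_cases l <;> simp <;> module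
    · fin_cases l <;> fin_cases k <;> simp at h ⊢ <;> module
  · refine ⟨if l = k then -t else 0, ?_⟩
    simp only [smoothEigen, mulVec_add, mulVec_sub, mulVec_smul, smoothX_eS, smoothX_eQ, smoothX_eV]
    by_cases h : l = k
    · subst h
      fin_cases l <;> simp <;> module
    · fin_cases l <;> fin_cases k <;> simp at h ⊢ <;> module
  · fin_cases o
    · refine ⟨0, ?_⟩
      simp only [smoothEigen, mulVec_add, mulVec_smul, smoothX_eS, smoothX_eV]
      fin_cases k <;> simp [Fin.ext_iff] <;> module
    · refine ⟨0, ?_⟩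
      simp only [smoothEigen, mulVec_add, mulVec_sub, mulVec_smul, smoothX_eS, smoothX_eQ,
        smoothX_eV, smoothX_eU]
      fin_cases k <;> simp [Fin.ext_iff] <;> module

theorem smoothZ_eigen (t : K) (v : Fin 3 → Fin 2 → K) (σ : Fin 2 → K)
    (r : (Fin 2 ⊕ Fin 3) ⊕ (Fin 3 ⊕ Fin 2)) :
    ∃ μ : K, smoothZ t v σ *ᵥ smoothEigen t v σ r = μ • smoothEigen t v σ r := by
  rcases r with (j | l) | (l | o)
  · exact ⟨_, smoothZ_eS ..⟩
  · refine ⟨0, ?_⟩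
    simp only [smoothEigen, mulVec_add, mulVec_smul, smoothZ_eS, smoothZ_eQ, smoothZ_eV]
    fin_cases l <;> simp [Fin.ext_iff] <;> module
  · refine ⟨0, ?_⟩
    simp only [smoothEigen, mulVec_add, mulVec_sub, mulVec_smul, smoothZ_eS, smoothZ_eQ, smoothZ_eV]
    fin_cases l <;> simp [Fin.ext_iff] <;> module
  · fin_cases o
    · refine ⟨t, ?_⟩
      simp only [smoothEigen, mulVec_add, mulVec_smul, smoothZ_eS, smoothZ_eV]
      simp
      module
    · refine ⟨0, ?_⟩
      simp only [smoothEigen, mulVec_add, mulVec_sub, mulVec_smul, smoothZ_eS, smoothZ_eQ,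
        smoothZ_eV, smoothZ_eU]
      simp
      module

theorem span_smoothEigen [CharZero K] {t : K} (ht : t ≠ 0) (v : Fin 3 → Fin 2 → K)
    (σ : Fin 2 → K) : Submodule.span K (Set.range (smoothEigen t v σ)) = ⊤ := by
  set M := Submodule.span K (Set.range (smoothEigen t v σ)) with hM
  have hmem : ∀ r, smoothEigen t v σ r ∈ M := fun r => Submodule.subset_span ⟨r, rfl⟩
  have hS : ∀ j, eS K j ∈ M := fun j => hmem (Sum.inl (Sum.inl j))
  have hS' : ∀ x y : K, x • eS K 0 + y • eS K 1 ∈ M := fun x y =>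
    M.add_mem (M.smul_mem _ (hS 0)) (M.smul_mem _ (hS 1))
  have hQ : ∀ k, eQ K k ∈ M := fun k => by
    rw [← M.smul_mem_iff (mul_ne_zero two_ne_zero ht)]
    convert M.add_mem (hmem (Sum.inl (Sum.inr k))) (hmem (Sum.inr (Sum.inl k))) using 1
    simp only [smoothEigen]
    module
  have hX : ∀ k : Fin 3, eV K k.castSucc ∈ M := fun k => by
    rw [← M.smul_mem_iff (pow_ne_zero 2 ht)]
    convert M.sub_mem (M.sub_mem (hmem (Sum.inl (Sum.inr k))) (M.smul_mem t (hQ k)))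
      (hS' (v k 0) (v k 1)) using 1
    simp only [smoothEigen]
    module
  have hZ : eV K 3 ∈ M := by
    rw [← M.smul_mem_iff ht]
    convert M.sub_mem (hmem (Sum.inr (Sum.inr 0))) (hS' (σ 0) (σ 1)) using 1
    simp only [smoothEigen]
    module
  refine mem_of_basis_mem M hS hQ (fun b => ?_) ?_
  · fin_cases b
    exacts [hX 0, hX 1, hX 2, hZ]
  · rw [← M.smul_mem_iff (pow_ne_zero 5 ht)]
    convert M.add_mem (hmem (Sum.inr (Sum.inr 1))) (M.add_mem (M.add_mem (hS' 1 1)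
      (M.smul_mem (t ^ 3) (M.add_mem (M.add_mem (hQ 0) (hQ 1)) (hQ 2))))
      (M.add_mem (M.smul_mem (t ^ 4) hZ) (M.smul_mem (t ^ 3) (hS' (σ 0) (σ 1))))) using 1
    simp only [smoothEigen]
    module

/-- The smoothing family: linear combinations of the deformed multiplications. -/
def smoothY {N : Type*} (l : N → Fin 3 → K) (m : N → K) (a : N → Fin 3 → K)
    (v : Fin 3 → Fin 2 → K) (σ : Fin 2 → K) (t : K) (i : N) : Matrix Idx Idx K :=
  ∑ k, l i k • smoothX t v σ k + m i • smoothZ t v σ +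
    ∑ k, a i k • (smoothX t v σ k * smoothX t v σ k)

theorem simDiag_smoothY [CharZero K] {N : Type*} (l : N → Fin 3 → K) (m : N → K)
    (a : N → Fin 3 → K) (v : Fin 3 → Fin 2 → K) (σ : Fin 2 → K) {t : K} (ht : t ≠ 0) :
    SimDiag (smoothY l m a v σ t) := by
  refine simDiag_of_span_eq_top _ ?_ (span_smoothEigen ht v σ)
  rintro _ ⟨r, rfl⟩ i
  choose μ hμ using fun k => smoothX_eigen t v σ k r
  obtain ⟨ν, hν⟩ := smoothZ_eigen t v σ r
  refine ⟨∑ k, l i k * μ k + m i * ν + ∑ k, a i k * μ k ^ 2, ?_⟩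
  simp only [smoothY, Fin.sum_univ_three, Matrix.add_mulVec, Matrix.smul_mulVec,
    ← Matrix.mulVec_mulVec, hμ, hν, Matrix.mulVec_smul]
  module

/-- The special member of the smoothing family: the multiplications by
`y_i = ∑ l_ik x_k + m_i z + ∑ a_ik q_k` in an algebra where the products of `x_k`, `z` are
`x_k ^ 2 = q_k`, `x_k q_k = v_k` and `z ^ 2 = σ`. -/
def normalForm {N : Type*} (l : N → Fin 3 → K) (m : N → K) (a : N → Fin 3 → K)
    (v : Fin 3 → Fin 2 → K) (σ : Fin 2 → K) (i : N) : Matrix Idx Idx K :=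
  Matrix.of fun p q => match p, q with
    | Sum.inl j, Sum.inr (Sum.inl k) => l i k * v k j
    | Sum.inl j, Sum.inr (Sum.inr (Sum.inl b)) =>
      ![a i 0 * v 0 j, a i 1 * v 1 j, a i 2 * v 2 j, m i * σ j] b
    | Sum.inr (Sum.inl k), Sum.inr (Sum.inr (Sum.inl b)) =>
      if b = k.castSucc then l i k else 0
    | Sum.inr (Sum.inl k), Sum.inr (Sum.inr (Sum.inr _)) => a i k
    | Sum.inr (Sum.inr (Sum.inl b)), Sum.inr (Sum.inr (Sum.inr _)) =>
      ![l i 0, l i 1, l i 2, m i] b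
    | _, _ => 0

theorem smoothY_zero {N : Type*} (l : N → Fin 3 → K) (m : N → K) (a : N → Fin 3 → K)
    (v : Fin 3 → Fin 2 → K) (σ : Fin 2 → K) :
    smoothY l m a v σ 0 = normalForm l m a v σ := by
  funext i
  have hX2 : ∀ k, smoothX 0 v σ k * smoothX 0 v σ k = Matrix.of fun p q => match p, q with
      | Sum.inl j, Sum.inr (Sum.inr (Sum.inl b)) => if b = k.castSucc then v k j else 0
      | Sum.inr (Sum.inl l), Sum.inr (Sum.inr (Sum.inr _)) => if l = k then 1 else 0
      | _, _ => 0 := fun k => by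
    ext p q
    rw [Matrix.mul_apply]
    simp only [Fintype.sum_sum_type]
    rcases p with i | l | b | o <;> rcases q with i' | l' | b' | o' <;>
      simp [smoothX, ite_and]
  simp only [smoothY, hX2]
  ext p q
  simp only [Matrix.add_apply, Fin.sum_univ_three, Matrix.smul_apply]
  rcases p with i | l | b | o <;> rcases q with i' | l' | b' | o' <;>
    simp [smoothX, smoothZ, normalForm]
  · fin_cases l' <;> simp
  · fin_cases b' <;> simp [Fin.ext_iff]
  · fin_cases l <;> simp
  · fin_cases l <;> simp
  · fin_cases b <;> simp [Fin.ext_iff]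

theorem normalForm_mem [CharZero K] {N : Type*} (l : N → Fin 3 → K) (m : N → K)
    (a : N → Fin 3 → K) (v : Fin 3 → Fin 2 → K) (σ : Fin 2 → K) :
    InSimDiagClosure (normalForm l m a v σ) := by
  rw [← smoothY_zero]
  refine InSimDiagClosure.of_generic (σ := Unit) (fun x => smoothY l m a v σ (x ()))
    (fun i p q => ?_) (fun x => x ()) (by fun_prop) 1 (by simp)
    (fun x hx => (simDiag_smoothY l m a v σ hx).inSimDiagClosure) 0
  have hX : ∀ k p q, PolyFun fun x : Unit → K => smoothX (x ()) v σ k p q := fun k p q => by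
    rcases p with i | l | b | o <;> rcases q with i' | l' | b' | o' <;>
      simp only [smoothX, Matrix.of_apply]
    any_goals (split_ifs <;> fun_prop)
    any_goals fun_prop
    fin_cases b' <;> simp <;> fun_prop
  have hZ : ∀ p q, PolyFun fun x : Unit → K => smoothZ (x ()) v σ p q := fun p q => by
    rcases p with i | l | b | o <;> rcases q with i' | l' | b' | o' <;>
      simp only [smoothZ, Matrix.of_apply]
    any_goals (split_ifs <;> fun_prop)
    any_goals fun_prop
    fin_cases b' <;> simp <;> fun_prop
  simp only [smoothY, Matrix.add_apply, Matrix.sum_apply, Matrix.smul_apply, Matrix.mul_apply,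
    smul_eq_mul]
  fun_prop

end Smoothing

section DiagData

variable {K : Type*} [Field K]

/-- The quadruple with multiplication tables `B` (linear forms times quadrics) and
`C`, `D` (socle and quadric components of products of linear forms). -/
def tuple1432 (B : Fin 4 → Matrix (Fin 2) (Fin 3) K) (C : Fin 4 → Fin 4 → Fin 2 → K)
    (D : Fin 4 → Fin 4 → Fin 3 → K) (i : Fin 4) : Matrix Idx Idx K :=
  blockMat1432 (B i) (Matrix.of fun j b => C i b j) (Matrix.of fun k b => D i b k) (Pi.single i 1)

/-- The quadric and cubic parts of the multiplication table are such that every completion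
by a symmetric socle part lies in the closure. -/
def Good (B : Fin 4 → Matrix (Fin 2) (Fin 3) K) (D : Fin 4 → Fin 4 → Fin 3 → K) : Prop :=
  ∀ C : Fin 4 → Fin 4 → Fin 2 → K, (∀ i j, C i j = C j i) → InSimDiagClosure (tuple1432 B C D)

/-- The change of basis from the normal form. -/
def normalBase (G : Matrix (Fin 4) (Fin 4) K) (a : Fin 4 → Fin 3 → K) (γ : Fin 3 → Fin 2 → K) :
    Matrix Idx Idx K :=
  Matrix.fromBlocks 1 (Matrix.fromCols (Matrix.of fun j k => γ k j) 0) 0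
    (Matrix.fromBlocks 1 (Matrix.fromCols (Matrix.of fun k b => a b k) 0) 0
      (Matrix.fromBlocks Gᵀ 0 0 1))

theorem normalForm_mul_base (G : Matrix (Fin 4) (Fin 4) K) (a : Fin 4 → Fin 3 → K)
    (v γ : Fin 3 → Fin 2 → K) (σ : Fin 2 → K) (i : Fin 4) :
    normalForm (fun i k => G i k.castSucc) (fun i => G i 3) a v σ i * normalBase G a γ =
    normalBase G a γ * tuple1432 (fun i => Matrix.of fun j k => G i k.castSucc * v k j)
      (fun i b j => ∑ k, (G i k.castSucc * a b k + a i k * G b k.castSucc) * v k j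
        + G i 3 * G b 3 * σ j - ∑ k, G i k.castSucc * G b k.castSucc * γ k j)
      (fun i b k => G i k.castSucc * G b k.castSucc) i := by
  ext p q
  rw [Matrix.mul_apply, Matrix.mul_apply]
  simp only [Fintype.sum_sum_type]
  rcases p with j | l | b | o <;> rcases q with j' | l' | b' | o' <;>
    simp [normalForm, normalBase, tuple1432, blockMat1432, Matrix.one_apply, Pi.single_apply]
  · simp [Fin.sum_univ_four, Fin.sum_univ_three]
    ring
  · exact fun h => absurd (Subsingleton.elim _ _) h
  · rw [Subsingleton.elim o' 0]
    fin_cases b <;> simp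

theorem tuple1432_diag [CharZero K] (G : Matrix (Fin 4) (Fin 4) K) (hG : G.det ≠ 0)
    (a : Fin 4 → Fin 3 → K) (v γ : Fin 3 → Fin 2 → K) (σ : Fin 2 → K) :
    InSimDiagClosure (tuple1432 (fun i => Matrix.of fun j k => G i k.castSucc * v k j)
      (fun i b j => ∑ k, (G i k.castSucc * a b k + a i k * G b k.castSucc) * v k j
        + G i 3 * G b 3 * σ j - ∑ k, G i k.castSucc * G b k.castSucc * γ k j)
      (fun i b k => G i k.castSucc * G b k.castSucc)) := by
  have hdet : IsUnit (normalBase G a γ) := by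
    rw [Matrix.isUnit_iff_isUnit_det]
    simpa [normalBase, Matrix.det_fromBlocks_zero₂₁] using hG
  have hinv : normalBase G a γ * (normalBase G a γ)⁻¹ = 1 :=
    Matrix.mul_nonsing_inv _ ((Matrix.isUnit_iff_isUnit_det _).mp hdet)
  have hinv' : (normalBase G a γ)⁻¹ * normalBase G a γ = 1 :=
    Matrix.nonsing_inv_mul _ ((Matrix.isUnit_iff_isUnit_det _).mp hdet)
  refine (normalForm_mem (fun i k => G i k.castSucc) (fun i => G i 3) a v σ).conj
    (normalBase G a γ)⁻¹ (Matrix.isUnit_nonsing_inv_iff.mpr hdet) fun i => ?_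
  have := normalForm_mul_base G a v γ σ i
  calc _ = (normalBase G a γ)⁻¹ * (normalBase G a γ * _) * (normalBase G a γ)⁻¹ := by
        rw [← Matrix.mul_assoc, hinv', Matrix.one_mul]
    _ = _ := by
        rw [← this]
        simp only [Matrix.mul_assoc, hinv, Matrix.mul_one]

end DiagData

section DiagGood

variable {K : Type*} [Field K]

theorem PolyFun.prod {σ τ : Type*} (s : Finset τ) {F : τ → (σ → K) → K}
    (hF : ∀ i, PolyFun (F i)) : PolyFun (fun x => ∏ i ∈ s, F i x) := by
  choose p hp using hF
  exact ⟨∏ i ∈ s, p i, fun x => by simp [hp]⟩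

theorem PolyFun.det {σ ι : Type*} [Fintype ι] [DecidableEq ι] {M : (σ → K) → Matrix ι ι K}
    (hM : ∀ i j, PolyFun fun x => M x i j) : PolyFun fun x => (M x).det := by
  simp only [Matrix.det_apply']
  exact PolyFun.sum _ fun p => (PolyFun.const _).mul (PolyFun.prod _ fun i => hM _ _)

theorem PolyFun.adjugate {σ ι : Type*} [Fintype ι] [DecidableEq ι] {M : (σ → K) → Matrix ι ι K}
    (hM : ∀ i j, PolyFun fun x => M x i j) (i j : ι) :
    PolyFun fun x => (M x).adjugate i j := by
  simp only [Matrix.adjugate_apply]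
  refine PolyFun.det fun a b => ?_
  simp only [Matrix.updateRow_apply]
  split_ifs
  · exact PolyFun.const _
  · exact hM _ _

theorem polyFun_tuple1432 {σ : Type*} {B : (σ → K) → Fin 4 → Matrix (Fin 2) (Fin 3) K}
    {C : (σ → K) → Fin 4 → Fin 4 → Fin 2 → K} {D : (σ → K) → Fin 4 → Fin 4 → Fin 3 → K}
    (hB : ∀ i j k, PolyFun fun x => B x i j k) (hC : ∀ i b j, PolyFun fun x => C x i b j)
    (hD : ∀ i b k, PolyFun fun x => D x i b k) (i : Fin 4) (p q : Idx) :
    PolyFun fun x => tuple1432 (B x) (C x) (D x) i p q := by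
  rcases p with j | l | b | o <;> rcases q with j' | l' | b' | o' <;>
    simp only [tuple1432, blockMat1432, Matrix.of_apply]
  all_goals fun_prop

theorem Good.of_generic [Infinite K] {σ : Type*} {B : (σ → K) → Fin 4 → Matrix (Fin 2) (Fin 3) K}
    {D : (σ → K) → Fin 4 → Fin 4 → Fin 3 → K}
    (hB : ∀ i j k, PolyFun fun x => B x i j k)
    (hD : ∀ i b k, PolyFun fun x => D x i b k) (h : (σ → K) → K) (hh : PolyFun h)
    (x₁ : σ → K) (h₁ : h x₁ ≠ 0) (hgen : ∀ x, h x ≠ 0 → Good (B x) (D x)) (x : σ → K) :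
    Good (B x) (D x) := fun C hC =>
  InSimDiagClosure.of_generic (fun x => tuple1432 (B x) C (D x))
    (polyFun_tuple1432 hB (fun _ _ _ => PolyFun.const _) hD) h hh x₁ h₁
    (fun x hx => hgen x hx C hC) x

theorem tuple1432_quadric_change {B B' : Fin 4 → Matrix (Fin 2) (Fin 3) K}
    {C : Fin 4 → Fin 4 → Fin 2 → K}
    {D D' : Fin 4 → Fin 4 → Fin 3 → K} (h : InSimDiagClosure (tuple1432 B C D))
    (P : Matrix (Fin 3) (Fin 3) K) (hP : IsUnit P)
    (hB : ∀ i, B' i * P = B i) (hD : ∀ i b, D' i b = P *ᵥ D i b) :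
    InSimDiagClosure (tuple1432 B' C D') := by
  let g : Matrix Idx Idx K := Matrix.fromBlocks 1 0 0 (Matrix.fromBlocks P 0 0 1)
  have hg : IsUnit g := by
    rw [Matrix.isUnit_iff_isUnit_det] at hP ⊢
    simpa [g, Matrix.det_fromBlocks_zero₂₁] using hP
  refine h.conj g hg fun i => ?_
  ext p q
  rw [Matrix.mul_apply, Matrix.mul_apply]
  simp only [Fintype.sum_sum_type]
  rcases p with j | l | b | o <;> rcases q with j' | l' | b' | o' <;>
    simp [g, tuple1432, blockMat1432, Matrix.one_apply, hD, Matrix.mulVec, dotProduct,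
      ← hB, Matrix.mul_apply]
  exact fun h => absurd (Subsingleton.elim _ _) h

theorem Good.quadric_change {B B' : Fin 4 → Matrix (Fin 2) (Fin 3) K}
    {D D' : Fin 4 → Fin 4 → Fin 3 → K} (h : Good B D) (P : Matrix (Fin 3) (Fin 3) K)
    (hP : IsUnit P) (hB : ∀ i, B' i * P = B i) (hD : ∀ i b, D' i b = P *ᵥ D i b) : Good B' D' :=
  fun C hC => tuple1432_quadric_change (h C hC) P hP hB hD

/-- The determinant of two plane vectors. -/
def det₂ (x y : Fin 2 → K) : K := x 0 * y 1 - x 1 * y 0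

theorem exists_comb_of_det₂_ne_zero {x y : Fin 2 → K} (h : det₂ x y ≠ 0) (z : Fin 2 → K) :
    ∃ r s : K, ∀ j, z j = r * x j + s * y j := by
  refine ⟨det₂ z y / det₂ x y, det₂ x z / det₂ x y, fun j => ?_⟩
  field_simp
  fin_cases j <;> simp [det₂] <;> ring

theorem tuple1432_diag_of_generic [CharZero K] (G : Matrix (Fin 4) (Fin 4) K) (hG : G.det ≠ 0)
    (v : Fin 3 → Fin 2 → K) (C : Fin 4 → Fin 4 → Fin 2 → K) (hC : ∀ i j, C i j = C j i)
    (h01 : det₂ (v 0) (v 1) ≠ 0) (h02 : det₂ (v 0) (v 2) ≠ 0) (h12 : det₂ (v 1) (v 2) ≠ 0)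
    (h3 : ∀ k, det₂ (v k) (C 3 3) ≠ 0) :
    InSimDiagClosure (tuple1432 (fun i => Matrix.of fun j k => G i k.castSucc * v k j)
      (fun i b j => ∑ p, ∑ q, G i p * G b q * C p q j)
      (fun i b k => G i k.castSucc * G b k.castSucc)) := by
  choose β lam hβ using fun k : Fin 3 => exists_comb_of_det₂_ne_zero (h3 k) (C k.castSucc 3)
  obtain ⟨a10, a01, e01⟩ := exists_comb_of_det₂_ne_zero h01
    fun j => C 0 1 j - lam 0 * lam 1 * C 3 3 j
  obtain ⟨a20, a02, e02⟩ := exists_comb_of_det₂_ne_zero h02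
    fun j => C 0 2 j - lam 0 * lam 2 * C 3 3 j
  obtain ⟨a21, a12, e12⟩ := exists_comb_of_det₂_ne_zero h12
    fun j => C 1 2 j - lam 1 * lam 2 * C 3 3 j
  let U : Matrix (Fin 4) (Fin 4) K :=
    !![1, 0, 0, lam 0; 0, 1, 0, lam 1; 0, 0, 1, lam 2; 0, 0, 0, 1]
  have hU : U.det = 1 := by
    simp [U, Matrix.det_succ_row_zero, Fin.sum_univ_succ, Fin.succAbove]
  let a : Matrix (Fin 4) (Fin 3) K := !![0, a01, a02; a10, 0, a12; a20, a21, 0; β 0, β 1, β 2]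
  have key := tuple1432_diag (G * U) (by rw [Matrix.det_mul, hU, mul_one]; exact hG)
    (fun i k => ∑ p, G i p * a p k) v
    (fun k j => -(C k.castSucc k.castSucc j - lam k ^ 2 * C 3 3 j)) (C 3 3)
  have hcol : ∀ i (k : Fin 3), (G * U) i k.castSucc = G i k.castSucc := fun i k => by
    fin_cases k <;> simp [Matrix.mul_apply, Fin.sum_univ_four, U]
  have hcol3 : ∀ i, (G * U) i 3 = G i 0 * lam 0 + G i 1 * lam 1 + G i 2 * lam 2 + G i 3 :=
    fun i => by simp [Matrix.mul_apply, Fin.sum_univ_four, U]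
  simp only [hcol, hcol3] at key
  convert key using 2
  funext i b j
  have s10 := congrFun (hC 1 0) j
  have s20 := congrFun (hC 2 0) j
  have s21 := congrFun (hC 2 1) j
  have s30 := congrFun (hC 3 0) j
  have s31 := congrFun (hC 3 1) j
  have s32 := congrFun (hC 3 2) j
  have b0 := hβ 0 j
  have b1 := hβ 1 j
  have b2 := hβ 2 j
  have f01 := e01 j
  have f02 := e02 j
  have f12 := e12 j
  simp only [Fin.sum_univ_four, Fin.sum_univ_three, Fin.castSucc_zero, Fin.castSucc_one,
    show (Fin.castSucc 2 : Fin 4) = 2 from rfl, a, Matrix.of_apply, Matrix.cons_val,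
    s10, s20, s21, s30, s31, s32] at b0 b1 b2 ⊢
  linear_combination (G i 0 * G b 1 + G i 1 * G b 0) * f01 + (G i 0 * G b 2 + G i 2 * G b 0) * f02
    + (G i 1 * G b 2 + G i 2 * G b 1) * f12 + (G i 0 * G b 3 + G i 3 * G b 0) * b0
    + (G i 1 * G b 3 + G i 3 * G b 1) * b1 + (G i 2 * G b 3 + G i 3 * G b 2) * b2

/-- Weighted diagonal data lie in the closure under an explicit nondegeneracy condition. -/
theorem tuple1432_weighted_diag_of_generic [CharZero K] (l : Fin 4 → Fin 3 → K) (w : Fin 3 → K)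
    (v : Fin 3 → Fin 2 → K) (C S : Fin 4 → Fin 4 → Fin 2 → K) (hC : ∀ i j, C i j = C j i)
    (G : Matrix (Fin 4) (Fin 4) K) (hG : ∀ i (k : Fin 3), G i k.castSucc = l i k)
    (hS : ∀ p q j, S p q j = ∑ a, ∑ b, G.adjugate p a * G.adjugate q b * C a b j)
    (ht : G.det * ((∏ k, w k) * ((det₂ (v 0) (v 1) * det₂ (v 0) (v 2) * det₂ (v 1) (v 2)) *
      ∏ k, det₂ (v k) (S 3 3))) ≠ 0) :
    InSimDiagClosure (tuple1432 (fun i => Matrix.of fun j k => l i k * v k j) C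
      (fun i b k => w k * (l i k * l b k))) := by
  obtain ⟨hdet, ht⟩ := mul_ne_zero_iff.mp ht
  obtain ⟨hw, ht⟩ := mul_ne_zero_iff.mp ht
  obtain ⟨hv, hs⟩ := mul_ne_zero_iff.mp ht
  obtain ⟨hv', h12⟩ := mul_ne_zero_iff.mp hv
  obtain ⟨h01, h02⟩ := mul_ne_zero_iff.mp hv'
  rw [Finset.prod_ne_zero_iff] at hw hs
  have hw : ∀ k, w k ≠ 0 := fun k => hw k (Finset.mem_univ _)
  have hs : ∀ k, det₂ (v k) (S 3 3) ≠ 0 := fun k => hs k (Finset.mem_univ _)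
  have hdv : ∀ (x y : Fin 2 → K) (r s : K), r ≠ 0 → s ≠ 0 → det₂ x y ≠ 0 →
      det₂ (fun j => r * x j) (fun j => s * y j) ≠ 0 := fun x y r s hr hs' h => by
    have : det₂ (fun j => r * x j) (fun j => s * y j) = r * s * det₂ x y := by
      simp only [det₂]; ring
    rw [this]
    exact mul_ne_zero (mul_ne_zero hr hs') h
  have hd2 : ((G.det ^ 2)⁻¹ : K) ≠ 0 := inv_ne_zero (pow_ne_zero 2 hdet)
  have base := tuple1432_diag_of_generic G hdet (fun k j => w k * v k j)
    (fun p q j => (G.det ^ 2)⁻¹ * S p q j)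
    (fun p q => by
      funext j
      rw [hS, hS, Finset.sum_comm]
      congr 1
      refine Finset.sum_congr rfl fun a _ => Finset.sum_congr rfl fun b _ => ?_
      rw [hC]
      ring)
    (hdv _ _ _ _ (hw _) (hw _) h01) (hdv _ _ _ _ (hw _) (hw _) h02)
    (hdv _ _ _ _ (hw _) (hw _) h12) fun k => hdv _ _ _ _ (hw k) hd2 (hs k)
  refine tuple1432_quadric_change (C := C) ?_ (Matrix.diagonal w) ?_ ?_ ?_
    (B := fun i => Matrix.of fun j k => G i k.castSucc * (w k * v k j))
    (D := fun i b k => G i k.castSucc * G b k.castSucc)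
  · convert base using 2
    funext i b j
    have hadj : ∀ x a, ∑ p, G x p * G.adjugate p a = if x = a then G.det else 0 := fun x a => by
      rw [← Matrix.mul_apply, Matrix.mul_adjugate]
      simp [Matrix.one_apply]
    have e : ∑ p, ∑ q, G i p * G b q * ((G.det ^ 2)⁻¹ * S p q j) = (G.det ^ 2)⁻¹ *
        ∑ a, ∑ c, (∑ p, G i p * G.adjugate p a) * (∑ q, G b q * G.adjugate q c) * C a c j := by
      simp only [hS, Fin.sum_univ_four]
      ring
    rw [e]
    simp only [hadj]
    simp
    field_simp
  · rw [Matrix.isUnit_iff_isUnit_det, Matrix.det_diagonal, isUnit_iff_ne_zero]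
    exact Finset.prod_ne_zero_iff.mpr fun k _ => hw k
  · intro i
    ext j k
    simp [hG]
    ring
  · intro i b
    funext k
    simp [hG, Matrix.mulVec_diagonal]

/-- Weighted diagonal data lie in the closure for every symmetric socle part. -/
theorem good_diag [CharZero K] (l : Fin 4 → Fin 3 → K) (w : Fin 3 → K) (v : Fin 3 → Fin 2 → K) :
    Good (fun i => Matrix.of fun j k => l i k * v k j) (fun i b k => w k * (l i k * l b k)) := by
  intro C hC
  have : Infinite K := inferInstance
  obtain ⟨L, hL⟩ : ∃ L : (Unit → K) → Fin 4 → Fin 3 → K, L = fun x i k =>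
    l i k + x () * ((if i = k.castSucc then 1 else 0) - l i k) := ⟨_, rfl⟩
  obtain ⟨W, hW⟩ : ∃ W : (Unit → K) → Fin 3 → K, W = fun x k => w k + x () * (1 - w k) := ⟨_, rfl⟩
  obtain ⟨V, hV⟩ : ∃ V : (Unit → K) → Fin 3 → Fin 2 → K, V = fun x k j =>
    v k j + x () * (![![1, 0], ![0, 1], ![1, 1]] k j - v k j) := ⟨_, rfl⟩
  obtain ⟨E, hE⟩ : ∃ E : (Unit → K) → Fin 4 → Fin 4 → Fin 2 → K, E = fun x i b j =>
    C i b j + x () * ((if i = 3 ∧ b = 3 then ![1, 2] j else 0) - C i b j) := ⟨_, rfl⟩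
  obtain ⟨G, hG⟩ : ∃ G : (Unit → K) → Matrix (Fin 4) (Fin 4) K, G = fun x => Matrix.of fun i p =>
    ![L x i 0, L x i 1, L x i 2, if i = 3 then 1 else 0] p := ⟨_, rfl⟩
  obtain ⟨A, hA⟩ : ∃ A : (Unit → K) → Matrix (Fin 4) (Fin 4) K, A = fun x => (G x).adjugate :=
    ⟨_, rfl⟩
  obtain ⟨S, hS⟩ : ∃ S : (Unit → K) → Fin 4 → Fin 4 → Fin 2 → K, S = fun x p q j =>
    ∑ a, ∑ b, A x p a * A x q b * E x a b j := ⟨_, rfl⟩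
  have pL : ∀ i k, PolyFun fun x => L x i k := fun i k => by simp only [hL]; fun_prop
  have pW : ∀ k, PolyFun fun x => W x k := fun k => by simp only [hW]; fun_prop
  have pV : ∀ k j, PolyFun fun x => V x k j := fun i k => by simp only [hV]; fun_prop
  have pE : ∀ i b j, PolyFun fun x => E x i b j := fun i k j => by simp only [hE]; fun_prop
  have pG : ∀ i p, PolyFun fun x => G x i p := fun i p => by
    simp only [hG, Matrix.of_apply]
    fin_cases p
    exacts [pL i 0, pL i 1, pL i 2, PolyFun.const _]
  have pA : ∀ i j, PolyFun fun x => A x i j := by rw [hA]; exact PolyFun.adjugate pG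
  have pS : ∀ p q j, PolyFun fun x => S x p q j := fun p q j => by simp only [hS]; fun_prop
  have hG1 : G 1 = 1 := by
    ext i p
    fin_cases p <;> simp [hG, hL, Matrix.one_apply]
  have hS1 : S 1 3 3 = ![1, 2] := by
    funext j
    simp [hS, hA, hG1, hE, Fin.sum_univ_four]
  have hV1 : V 1 = ![![1, 0], ![0, 1], ![1, 1]] := by
    funext k j
    simp [hV]
  have := InSimDiagClosure.of_generic (fun x => tuple1432
      (fun i => Matrix.of fun j k => L x i k * V x k j) (E x)
      (fun i b k => W x k * (L x i k * L x b k)))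
    (polyFun_tuple1432 (fun i j k => (pL i k).mul (pV k j)) pE
      fun i b k => (pW k).mul ((pL i k).mul (pL b k)))
    (fun x => (G x).det * ((∏ k, W x k) * ((det₂ (V x 0) (V x 1) * det₂ (V x 0) (V x 2) *
      det₂ (V x 1) (V x 2)) * ∏ k, det₂ (V x k) (S x 3 3))))
    (by
      refine (PolyFun.det pG).mul ((PolyFun.prod _ pW).mul
        (PolyFun.mul ?_ (PolyFun.prod _ fun k => ?_)))
      all_goals simp only [det₂]; fun_prop)
    1 (by
      simp only [hG1, hS1, hV1]
      simp [hW, det₂, Fin.prod_univ_three]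
      norm_num)
    (fun x hx => tuple1432_weighted_diag_of_generic (L x) (W x) (V x) (E x) (S x)
      (fun i j => by
        funext k
        simp only [hE, hC i j, and_comm])
      (G x) (fun i k => by fin_cases k <;> simp [hG])
      (fun p q j => by simp only [hS, hA]) hx) 0
  simpa [hL, hV, hE, hW] using this

end DiagGood

section LambdaData

variable {K : Type*} [Field K]

theorem PolyFun.polynomial_eval {σ : Type*} {f : (σ → K) → K} (hf : PolyFun f)
    (r : Polynomial K) : PolyFun fun x => r.eval (f x) := by
  simp only [Polynomial.eval_eq_sum_range]
  exact PolyFun.sum _ fun i => (PolyFun.const _).mul (hf.pow i)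

theorem span_eigenvectors_of_separable [IsAlgClosed K] {ι : Type*} [Fintype ι] [DecidableEq ι]
    (N : Matrix ι ι K) (h : N.charpoly.Separable) :
    Submodule.span K {w | ∃ μ : K, N *ᵥ w = μ • w} = ⊤ := by
  have hss : Module.End.IsSemisimple (Matrix.toLin' N) :=
    Module.End.isSemisimple_of_squarefree_aeval_eq_zero (p := N.charpoly) h.squarefree (by
      rw [← Matrix.charpoly_toLin', LinearMap.aeval_self_charpoly])
  rw [eq_top_iff, ← hss.iSup_eigenspace_eq_top, iSup_le_iff]
  intro μ w hw
  refine Submodule.subset_span ⟨μ, ?_⟩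
  rw [Module.End.mem_eigenspace_iff, Matrix.toLin'_apply] at hw
  exact hw

theorem exists_generic_separable [CharZero K] (N : Matrix (Fin 3) (Fin 3) K) :
    ∃ r : Polynomial K, r.eval 1 ≠ 0 ∧ ∀ t, r.eval t ≠ 0 →
      (N + t • (Matrix.diagonal ![0, 1, 2] - N)).charpoly.Separable := by
  let M : Matrix (Fin 3) (Fin 3) (Polynomial K) := N.map Polynomial.C +
    (Polynomial.X : Polynomial K) • ((Matrix.diagonal ![0, 1, 2] - N).map Polynomial.C)
  have hM : ∀ t : K, M.map (Polynomial.evalRingHom t) =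
      N + t • (Matrix.diagonal ![0, 1, 2] - N) := fun t => by
    ext i j
    simp [M]
  have hr : ∀ t : K, (Polynomial.resultant M.charpoly M.charpoly.derivative 3 2).eval t =
      Polynomial.resultant (N + t • (Matrix.diagonal ![0, 1, 2] - N)).charpoly
        (N + t • (Matrix.diagonal ![0, 1, 2] - N)).charpoly.derivative := fun t => by
    have hdeg := Matrix.charpoly_natDegree_eq_dim (N + t • (Matrix.diagonal ![0, 1, 2] - N))
    rw [Fintype.card_fin] at hdeg
    have hdeg' : (N + t • (Matrix.diagonal ![0, 1, 2] - N)).charpoly.derivative.natDegree = 2 := by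
      rw [Polynomial.natDegree_derivative, hdeg]
    rw [hdeg, hdeg', ← hM, Matrix.charpoly_map, Polynomial.derivative_map,
      Polynomial.resultant_map_map]
    rfl
  have hsep : ∀ t : K, (Polynomial.resultant M.charpoly M.charpoly.derivative 3 2).eval t ≠ 0 ↔
      (N + t • (Matrix.diagonal ![0, 1, 2] - N)).charpoly.Separable := fun t => by
    rw [hr, ← isUnit_iff_ne_zero,
      Polynomial.isUnit_resultant_iff_isCoprime (Matrix.charpoly_monic _)]
    rfl
  refine ⟨_, (hsep 1).mpr ?_, fun t => (hsep t).mp⟩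
  rw [one_smul, add_sub_cancel, Matrix.charpoly_diagonal, Polynomial.separable_prod_X_sub_C_iff]
  intro i j h
  fin_cases i <;> fin_cases j <;> simp_all

/-- Tuples of quadratic polynomials in one `3 × 3` matrix lie in the closure. -/
theorem closure_of_single [CharZero K] [IsAlgClosed K] {ι : Type*} (N : Matrix (Fin 3) (Fin 3) K)
    (a b c : ι → K) : InSimDiagClosure fun i => a i • 1 + b i • N + c i • (N * N) := by
  obtain ⟨r, h1, hr⟩ := exists_generic_separable N
  obtain ⟨M, hM⟩ : ∃ M : (Unit → K) → Matrix (Fin 3) (Fin 3) K, M = fun x =>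
    N + x () • (Matrix.diagonal ![0, 1, 2] - N) := ⟨_, rfl⟩
  have pM : ∀ i j, PolyFun fun x => M x i j := fun i j => by
    simp only [hM, Matrix.add_apply, Matrix.smul_apply, smul_eq_mul]
    fun_prop
  have := InSimDiagClosure.of_generic (fun x i => a i • 1 + b i • M x + c i • (M x * M x))
    (fun i p q => by
      simp only [Matrix.add_apply, Matrix.smul_apply, smul_eq_mul, Matrix.mul_apply]
      fun_prop) (fun x => r.eval (x ())) (PolyFun.polynomial_eval (by fun_prop) r) 1 h1
    (fun x hx => (simDiag_of_span_eq_top _ (fun w hw i => ?_)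
      (span_eigenvectors_of_separable _ (hr _ hx))).inSimDiagClosure) 0
  · simpa [hM] using this
  · obtain ⟨μ, hμ⟩ := hw
    have hμ' : M x *ᵥ w = μ • w := by rw [hM]; exact hμ
    refine ⟨a i + b i * μ + c i * μ ^ 2, ?_⟩
    simp only [Matrix.add_mulVec, Matrix.smul_mulVec, Matrix.one_mulVec, ← Matrix.mulVec_mulVec,
      hμ', Matrix.mulVec_smul]
    module

/-- The algebra of `3 × 3` matrices with two square-zero generators lies in the closure. -/
theorem closure_of_square_zero [CharZero K] {ι : Type*} (a b c : ι → K) :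
    InSimDiagClosure fun i => !![a i, 0, 0; b i, a i, 0; c i, 0, a i] := by
  have := InSimDiagClosure.of_generic (K := K) (σ := Unit) (fun x i =>
      !![a i, 0, 0; b i, a i + b i * x (), 0; c i, 0, a i + c i * x ()])
    (fun i p q => by
      fin_cases p <;> fin_cases q <;> simp <;> fun_prop)
    (fun x => x ()) (by fun_prop) 1 (by simp)
    (fun x hx => (simDiag_of_span_eq_top {![0, 1, 0], ![0, 0, 1], ![x (), -1, -1]}
      (fun w hw i => ?_) ?_).inSimDiagClosure) 0
  · simpa using this
  · rcases hw with rfl | rfl | rfl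
    · refine ⟨a i + b i * x (), ?_⟩
      ext k
      fin_cases k <;> simp [Matrix.mulVec, dotProduct, Fin.sum_univ_three]
    · refine ⟨a i + c i * x (), ?_⟩
      ext k
      fin_cases k <;> simp [Matrix.mulVec, dotProduct, Fin.sum_univ_three]
    · refine ⟨a i, ?_⟩
      ext k
      fin_cases k <;> simp [Matrix.mulVec, dotProduct, Fin.sum_univ_three]
  · rw [eq_top_iff]
    intro y _
    set W : Set (Fin 3 → K) := {![0, 1, 0], ![0, 0, 1], ![x (), -1, -1]}
    have e1 : ![0, 1, 0] ∈ Submodule.span K W := Submodule.subset_span (by simp [W])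
    have e2 : ![0, 0, 1] ∈ Submodule.span K W := Submodule.subset_span (by simp [W])
    have e3 : ![x (), -1, -1] ∈ Submodule.span K W := Submodule.subset_span (by simp [W])
    convert Submodule.add_mem _ (Submodule.add_mem _ (Submodule.smul_mem _ (y 1 + y 0 / x ()) e1)
      (Submodule.smul_mem _ (y 2 + y 0 / x ()) e2)) (Submodule.smul_mem _ (y 0 / x ()) e3) using 1
    ext k
    fin_cases k <;> simp [hx]

/-- Data coming from a quadruple of commuting `3 × 3` matrices in the closure are good. -/
theorem good_of_closure [CharZero K] {Λ : Fin 4 → Matrix (Fin 3) (Fin 3) K}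
    (h : InSimDiagClosure Λ) (g : Fin 3 → K) (L : Matrix (Fin 2) (Fin 3) K) :
    Good (fun i => L * Λ i) (fun i b => (Λ i * Λ b) *ᵥ g) := by
  intro C hC
  refine h.map (fun x => tuple1432 (fun i => L * Matrix.of fun p q => x (i, p, q)) C
    (fun i b => ((Matrix.of fun p q => x (i, p, q)) * (Matrix.of fun p q => x (b, p, q))) *ᵥ g))
    (polyFun_tuple1432 (fun i j k => ?_) (fun _ _ _ => PolyFun.const _) fun i b k => ?_) ?_
  · simp only [Matrix.mul_apply, Matrix.of_apply]
    fun_prop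
  · simp only [Matrix.mulVec, dotProduct, Matrix.mul_apply, Matrix.of_apply]
    fun_prop
  · rintro A ⟨P, hP, hA⟩
    have hP' := (Matrix.isUnit_iff_isUnit_det P).mp hP
    have hAP : ∀ i, A i * P = P * Matrix.diagonal fun k => (P⁻¹ * A i * P) k k := fun i => by
      have : Matrix.diagonal (fun k => (P⁻¹ * A i * P) k k) = P⁻¹ * A i * P := (hA i).diagonal_diag
      rw [this, Matrix.mul_assoc, ← Matrix.mul_assoc, Matrix.mul_nonsing_inv _ hP', Matrix.one_mul]
    have key := good_diag (fun i k => (P⁻¹ * A i * P) k k) (P⁻¹ *ᵥ g) (fun k j => (L * P) j k)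
    refine key.quadric_change P hP (fun i => ?_) (fun i b => ?_) C hC
    · change L * A i * P = _
      rw [Matrix.mul_assoc, hAP, ← Matrix.mul_assoc]
      ext j k
      simp [mul_comm]
    · have : (fun k => (P⁻¹ *ᵥ g) k * ((P⁻¹ * A i * P) k k * (P⁻¹ * A b * P) k k)) =
          (Matrix.diagonal fun k => (P⁻¹ * A i * P) k k) *ᵥ
            (Matrix.diagonal fun k => (P⁻¹ * A b * P) k k) *ᵥ (P⁻¹ *ᵥ g) := by
        funext k
        simp only [Matrix.mulVec_diagonal]
        ring
      change (A i * A b) *ᵥ g = _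
      rw [this, Matrix.mulVec_mulVec, ← hAP, Matrix.mulVec_mulVec, Matrix.mul_assoc, ← hAP,
        Matrix.mulVec_mulVec]
      simp only [Matrix.mul_assoc, Matrix.mul_nonsing_inv _ hP', Matrix.mul_one]

end LambdaData

section Cubic

variable {K : Type*} [Field K]

/-- All quadruples of linear forms give good data, for the algebra of dimension 3 in degree 2 with
one cubic form `F` and a second cubic form obtained from it by contraction with `M`. -/
def CubicGood (F : Fin 3 → Fin 3 → Fin 3 → K) (M : Matrix (Fin 3) (Fin 3) K) : Prop :=
  ∀ β : Fin 4 → Fin 3 → K, Good (fun i => Matrix.of ![β i, β i ᵥ* M])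
    (fun i b j => ∑ k, ∑ l, β i k * β b l * F j k l)

theorem CubicGood.of_generic [Infinite K] {σ : Type*} {F : (σ → K) → Fin 3 → Fin 3 → Fin 3 → K}
    (M : Matrix (Fin 3) (Fin 3) K)
    (hF : ∀ j k l, PolyFun fun x => F x j k l) (h : (σ → K) → K) (hh : PolyFun h)
    (x₁ : σ → K) (h₁ : h x₁ ≠ 0) (hgen : ∀ x, h x ≠ 0 → CubicGood (F x) M) (x : σ → K) :
    CubicGood (F x) M := fun β =>
  Good.of_generic (B := fun _ i => Matrix.of ![β i, β i ᵥ* M])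
    (D := fun x i b j => ∑ k, ∑ l, β i k * β b l * F x j k l)
    (fun _ _ _ => PolyFun.const _) (fun i b k => by fun_prop) h hh x₁ h₁ (fun x hx => hgen x hx β) x

theorem CubicGood.change {F : Fin 3 → Fin 3 → Fin 3 → K} {M P Q : Matrix (Fin 3) (Fin 3) K}
    (hPQ : P * Q = 1)
    (h : CubicGood (fun a b c => ∑ j, ∑ k, ∑ l, Q a j * Q b k * Q c l * F j k l) (Q * M * P)) :
    CubicGood F M := by
  intro β
  have hP : IsUnit P := IsUnit.of_mul_eq_one Q hPQ
  refine (h fun i => β i ᵥ* P).quadric_change P hP (fun i => ?_) fun i b => ?_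
  · have e : β i ᵥ* P ᵥ* (Q * M * P) = β i ᵥ* M ᵥ* P := by
      rw [Matrix.vecMul_vecMul, ← Matrix.mul_assoc, ← Matrix.mul_assoc, hPQ, Matrix.one_mul,
        Matrix.vecMul_vecMul]
    rw [e]
    ext j k
    fin_cases j
    · simp [Matrix.mul_apply, Matrix.vecMul, dotProduct]
    · simp [Matrix.mul_apply, Matrix.vecMul, dotProduct, -Matrix.vecMul_vecMul]
  · have hγ : ∀ i, β i = β i ᵥ* P ᵥ* Q := fun i => by
      rw [Matrix.vecMul_vecMul, hPQ, Matrix.vecMul_one]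
    have e : (fun a => ∑ k, ∑ l, (β i ᵥ* P) k * (β b ᵥ* P) l *
        ∑ j, ∑ k', ∑ l', Q a j * Q k k' * Q l l' * F j k' l') =
        Q *ᵥ fun j => ∑ k, ∑ l, β i k * β b l * F j k l := by
      funext a
      conv_rhs => rw [hγ i, hγ b]
      generalize β i ᵥ* P = x
      generalize β b ᵥ* P = y
      simp only [Matrix.mulVec, Matrix.vecMul, dotProduct, Fin.sum_univ_three]
      ring
    rw [e, Matrix.mulVec_mulVec, hPQ, Matrix.one_mulVec]

/-- A cubic form compatible with a cyclic matrix comes from quadratic polynomials in it. -/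
theorem cubicGood_of_cyclic [CharZero K] [IsAlgClosed K] {F : Fin 3 → Fin 3 → Fin 3 → K}
    {M : Matrix (Fin 3) (Fin 3) K} (hsym : ∀ j k l, F j k l = F k j l)
    (hsym' : ∀ j k l, F j k l = F j l k)
    (N : Matrix (Fin 3) (Fin 3) K) (hN : ∀ j k l, ∑ i, N j i * F i k l = ∑ i, N k i * F i j l)
    (hNM : N * M = M * N) (g : Fin 3 → K)
    (hg : (Matrix.of ![g, g ᵥ* N, g ᵥ* N ᵥ* N]).det ≠ 0) : CubicGood F M := by
  intro β
  have hunit : IsUnit (Matrix.of ![g, g ᵥ* N, g ᵥ* N ᵥ* N]).det := isUnit_iff_ne_zero.mpr hg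
  obtain ⟨γ, hγ⟩ : ∃ γ : Fin 4 → Fin 3 → K, ∀ i, β i = γ i ᵥ* Matrix.of ![g, g ᵥ* N, g ᵥ* N ᵥ* N] :=
    ⟨fun i => β i ᵥ* (Matrix.of ![g, g ᵥ* N, g ᵥ* N ᵥ* N])⁻¹, fun i => by
      rw [Matrix.vecMul_vecMul, Matrix.nonsing_inv_mul _ hunit, Matrix.vecMul_one]⟩
  obtain ⟨Λ, hΛ⟩ : ∃ Λ : Fin 4 → Matrix (Fin 3) (Fin 3) K,
    Λ = fun i => γ i 0 • 1 + γ i 1 • N + γ i 2 • (N * N) := ⟨_, rfl⟩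
  have hgΛ : ∀ i, g ᵥ* Λ i = β i := fun i => by
    rw [hγ, hΛ]
    simp only [Matrix.vecMul_add, Matrix.vecMul_smul, Matrix.vecMul_one, ← Matrix.vecMul_vecMul]
    funext k
    simp [Matrix.vecMul, dotProduct, Fin.sum_univ_three]
  have hMΛ : ∀ i, Λ i * M = M * Λ i := fun i => by
    simp only [hΛ, Matrix.add_mul, Matrix.mul_add, Matrix.smul_mul, Matrix.mul_smul, Matrix.one_mul,
      Matrix.mul_one]
    rw [hNM, Matrix.mul_assoc N N M, hNM, ← Matrix.mul_assoc, hNM, Matrix.mul_assoc]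
  obtain ⟨T, hT⟩ : ∃ T : (Fin 3 → K) → (Fin 3 → K) → Fin 3 → K,
    T = fun ξ η j => ∑ k, ∑ l, ξ k * η l * F j k l := ⟨_, rfl⟩
  have hTs : ∀ ξ η, T ξ η = T η ξ := fun ξ η => by
    funext j
    simp only [hT]
    rw [Finset.sum_comm]
    refine Finset.sum_congr rfl fun k _ => Finset.sum_congr rfl fun l _ => ?_
    rw [hsym' j l k]
    ring
  have hTN : ∀ ξ η, T (ξ ᵥ* N) η = N *ᵥ T ξ η := fun ξ η => by
    funext j
    have e1 : T (ξ ᵥ* N) η j = ∑ a, ∑ l, ξ a * η l * ∑ k, N a k * F k j l := by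
      simp only [hT, Matrix.vecMul, dotProduct, Fin.sum_univ_three, hsym j]
      ring
    have e2 : (N *ᵥ T ξ η) j = ∑ a, ∑ l, ξ a * η l * ∑ k, N j k * F k a l := by
      simp only [hT, Matrix.mulVec, dotProduct, Fin.sum_univ_three]
      ring
    rw [e1, e2]
    simp only [hN j]
  have hTadd : ∀ ξ ξ' η, T (ξ + ξ') η = T ξ η + T ξ' η := fun ξ ξ' η => by
    funext j
    simp only [hT, Pi.add_apply, ← Finset.sum_add_distrib]
    simp only [add_mul]
  have hTsmul : ∀ (c : K) ξ η, T (c • ξ) η = c • T ξ η := fun c ξ η => by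
    funext j
    simp only [hT, Pi.smul_apply, smul_eq_mul, Finset.mul_sum]
    simp only [mul_assoc]
  have hTΛ : ∀ i ξ η, T (ξ ᵥ* Λ i) η = Λ i *ᵥ T ξ η := fun i ξ η => by
    simp only [hΛ, Matrix.vecMul_add, Matrix.vecMul_smul, Matrix.vecMul_one,
      ← Matrix.vecMul_vecMul, hTadd, hTsmul, hTN, Matrix.add_mulVec, Matrix.smul_mulVec,
      Matrix.one_mulVec, ← Matrix.mulVec_mulVec]
  have key := good_of_closure (Λ := Λ) (by rw [hΛ]; exact closure_of_single N _ _ _) (T g g)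
    (Matrix.of ![g, g ᵥ* M])
  convert key using 1
  · funext i
    ext j k
    fin_cases j
    · simpa [Matrix.mul_apply, Matrix.vecMul, dotProduct] using (congrFun (hgΛ i) k).symm
    · have e : β i ᵥ* M = g ᵥ* M ᵥ* Λ i := by
        rw [Matrix.vecMul_vecMul, ← hMΛ, ← Matrix.vecMul_vecMul, hgΛ]
      simpa [Matrix.mul_apply, Matrix.vecMul, dotProduct] using congrFun e k
  · funext i b
    rw [← Matrix.mulVec_mulVec, ← hTΛ, hgΛ, hTs, ← hTΛ, hgΛ, hT]

end Cubic

section CubicClassification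

variable {K : Type*} [Field K]

theorem cubicGood_diag_table [CharZero K] [IsAlgClosed K] (a b : K) (x : Fin 5 → K) :
    CubicGood ![![![x 0, x 1, 0], ![x 1, x 2, 0], ![0, 0, 0]],
      ![![x 1, x 2, 0], ![x 2, x 3, 0], ![0, 0, 0]], ![![0, 0, 0], ![0, 0, 0], ![0, 0, x 4]]]
      !![a, 0, 0; 0, a, 0; 0, 0, b] := by
  have : Infinite K := inferInstance
  refine CubicGood.of_generic _ (F := fun x : Fin 5 → K =>
    ![![![x 0, x 1, 0], ![x 1, x 2, 0], ![0, 0, 0]],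
      ![![x 1, x 2, 0], ![x 2, x 3, 0], ![0, 0, 0]], ![![0, 0, 0], ![0, 0, 0], ![0, 0, x 4]]])
    (fun j k l => ?_) (fun x => x 1 * x 3 - x 2 * x 2) (by fun_prop) ![0, 1, 0, 1, 0] (by simp)
    (fun x hx => ?_) x
  · fin_cases j <;> fin_cases k <;> fin_cases l <;> simp <;> fun_prop
  · obtain ⟨δ, hδ⟩ : ∃ δ, δ = x 0 * x 3 - x 1 * x 2 := ⟨_, rfl⟩
    obtain ⟨q, hq⟩ : ∃ q, q = x 1 * x 1 - x 0 * x 2 := ⟨_, rfl⟩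
    obtain ⟨r, hr⟩ : ∃ r, r = x 1 * x 3 - x 2 * x 2 := ⟨_, rfl⟩
    rw [← hr] at hx
    obtain ⟨lam, hlam⟩ : ∃ lam : K, lam * lam - δ * lam - r * q ≠ 0 := by
      by_contra! H
      have h0 := H 0
      have h1 := H 1
      have h2 := H 2
      have : (2 : K) = 0 := by linear_combination h2 - 2 * h1 + h0
      exact two_ne_zero this
    refine cubicGood_of_cyclic (fun j k l => ?_) (fun j k l => ?_)
      !![δ, q, 0; r, 0, 0; 0, 0, lam] (fun j k l => ?_) ?_ ![0, 1, 1] ?_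
    · fin_cases j <;> fin_cases k <;> fin_cases l <;> simp
    · fin_cases j <;> fin_cases k <;> fin_cases l <;> simp
    · fin_cases j <;> fin_cases k <;> fin_cases l <;> simp [Fin.sum_univ_three, hδ, hq, hr] <;> ring
    · ext i j
      fin_cases i <;> fin_cases j <;> simp [Matrix.mul_apply, Fin.sum_univ_three] <;> ring
    · have : (Matrix.of ![![0, 1, 1], ![0, 1, 1] ᵥ* !![δ, q, 0; r, 0, 0; 0, 0, lam],
          ![0, 1, 1] ᵥ* !![δ, q, 0; r, 0, 0; 0, 0, lam] ᵥ* !![δ, q, 0; r, 0, 0; 0, 0, lam]]).det =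
          -r * (lam * lam - δ * lam - r * q) := by
        simp [Matrix.det_fin_three]
        ring
      rw [this]
      exact mul_ne_zero (neg_ne_zero.mpr hx) hlam

theorem cubicGood_nilpotent_table [CharZero K] [IsAlgClosed K] (a : K) (x : Fin 5 → K) :
    CubicGood ![![![x 0, x 1, x 4], ![x 1, x 2, 0], ![x 4, 0, 0]],
      ![![x 1, x 2, 0], ![x 2, x 3, 0], ![0, 0, 0]], ![![x 4, 0, 0], ![0, 0, 0], ![0, 0, 0]]]
      !![a, 0, 1; 0, a, 0; 0, 0, a] := by
  have : Infinite K := inferInstance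
  refine CubicGood.of_generic _ (F := fun x : Fin 5 → K =>
    ![![![x 0, x 1, x 4], ![x 1, x 2, 0], ![x 4, 0, 0]],
      ![![x 1, x 2, 0], ![x 2, x 3, 0], ![0, 0, 0]], ![![x 4, 0, 0], ![0, 0, 0], ![0, 0, 0]]])
    (fun j k l => ?_) (fun x => x 3 * x 4) (by fun_prop) ![0, 0, 0, 1, 1] (by simp)
    (fun x hx => ?_) x
  · fin_cases j <;> fin_cases k <;> fin_cases l <;> simp <;> fun_prop
  · obtain ⟨h3, h4⟩ := mul_ne_zero_iff.mp hx
    obtain ⟨t, ht⟩ : ∃ t, (x 1 + t * x 4) * x 3 = x 2 * x 2 :=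
      ⟨(x 2 * x 2 / x 3 - x 1) / x 4, by field_simp; ring⟩
    refine cubicGood_of_cyclic (fun j k l => ?_) (fun j k l => ?_)
      !![0, x 2, 1 + x 2 * t; 0, x 3, x 3 * t; 0, 0, 0] (fun j k l => ?_) ?_
      ![1, (1 - x 2) / x 3, 0] ?_
    · fin_cases j <;> fin_cases k <;> fin_cases l <;> simp
    · fin_cases j <;> fin_cases k <;> fin_cases l <;> simp
    · fin_cases j <;> fin_cases k <;> fin_cases l <;> simp [Fin.sum_univ_three] <;>
        first | linear_combination ht | linear_combination -ht | ring
    · ext i j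
      fin_cases i <;> fin_cases j <;> simp [Matrix.mul_apply, Fin.sum_univ_three] <;> ring
    · have : (Matrix.of ![![1, (1 - x 2) / x 3, 0],
          ![1, (1 - x 2) / x 3, 0] ᵥ* !![0, x 2, 1 + x 2 * t; 0, x 3, x 3 * t; 0, 0, 0],
          ![1, (1 - x 2) / x 3, 0] ᵥ* !![0, x 2, 1 + x 2 * t; 0, x 3, x 3 * t; 0, 0, 0] ᵥ*
            !![0, x 2, 1 + x 2 * t; 0, x 3, x 3 * t; 0, 0, 0]]).det = -x 3 := by
        simp [Matrix.det_fin_three]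
        field_simp
        ring
      rw [this]
      exact neg_ne_zero.mpr h3

/-- A cubic tensor is symmetric, and remains so after applying `M` to one index. -/
structure IsCubicPair (F : Fin 3 → Fin 3 → Fin 3 → K) (M : Matrix (Fin 3) (Fin 3) K) : Prop where
  symm_left : ∀ j k l, F j k l = F k j l
  symm_right : ∀ j k l, F j k l = F j l k
  symm_mul : ∀ j k l, ∑ i, M j i * F i k l = ∑ i, M k i * F i j l

theorem IsCubicPair.change {F : Fin 3 → Fin 3 → Fin 3 → K} {M P Q : Matrix (Fin 3) (Fin 3) K}
    (h : IsCubicPair F M) (hPQ : P * Q = 1) :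
    IsCubicPair (fun a b c => ∑ j, ∑ k, ∑ l, Q a j * Q b k * Q c l * F j k l) (Q * M * P) where
  symm_left a b c := by
    rw [Finset.sum_comm]
    refine Finset.sum_congr rfl fun k _ => Finset.sum_congr rfl fun j _ =>
      Finset.sum_congr rfl fun l _ => ?_
    rw [h.symm_left]
    ring
  symm_right a b c := by
    refine Finset.sum_congr rfl fun j _ => ?_
    rw [Finset.sum_comm]
    refine Finset.sum_congr rfl fun l _ => Finset.sum_congr rfl fun k _ => ?_
    rw [h.symm_right]
    ring
  symm_mul a b c := by
    have hQ : Q * M * P * Q = Q * M := by rw [Matrix.mul_assoc, hPQ, Matrix.mul_one]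
    have key : ∀ a b, ∑ i, (Q * M * P) a i * (∑ j, ∑ k, ∑ l, Q i j * Q b k * Q c l * F j k l) =
        ∑ j, ∑ k, ∑ l, Q a j * Q b k * Q c l * ∑ i, M j i * F i k l := fun a b => by
      have e : ∀ j, ∑ i, (Q * M * P) a i * Q i j = ∑ i, Q a i * M i j := fun j => by
        have := congrFun (congrFun hQ a) j
        rwa [Matrix.mul_apply, Matrix.mul_apply] at this
      have e1 : ∑ i, (Q * M * P) a i * (∑ j, ∑ k, ∑ l, Q i j * Q b k * Q c l * F j k l) =
          ∑ j, ∑ k, ∑ l, (∑ i, (Q * M * P) a i * Q i j) * (Q b k * Q c l * F j k l) := by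
        generalize Q * M * P = R
        simp only [Fin.sum_univ_three]
        ring
      rw [e1]
      simp only [e, Fin.sum_univ_three]
      ring
    rw [key, key, Finset.sum_comm]
    refine Finset.sum_congr rfl fun k _ => Finset.sum_congr rfl fun j _ =>
      Finset.sum_congr rfl fun l _ => ?_
    rw [h.symm_mul]
    ring

theorem IsCubicPair.cubicGood_diag [CharZero K] [IsAlgClosed K]
    {F : Fin 3 → Fin 3 → Fin 3 → K} {a b : K} (hab : a ≠ b)
    (h : IsCubicPair F !![a, 0, 0; 0, a, 0; 0, 0, b]) :
    CubicGood F !![a, 0, 0; 0, a, 0; 0, 0, b] := by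
  have z : ∀ k l, k ≠ 2 → F 2 k l = 0 := fun k l hk => by
    have := h.symm_mul 2 k l
    have hs := h.symm_left k 2 l
    have hne : b - a ≠ 0 := sub_ne_zero.mpr hab.symm
    obtain rfl | rfl | rfl : k = 0 ∨ k = 1 ∨ k = 2 := by fin_cases k <;> simp
    all_goals simp [Fin.sum_univ_three] at this hs hk <;> rw [hs] at this <;>
        exact (mul_eq_zero.mp (show (b - a) * _ = 0 by linear_combination this)).resolve_left hne
  convert cubicGood_diag_table a b ![F 0 0 0, F 0 0 1, F 0 1 1, F 1 1 1, F 2 2 2] using 1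
  funext j k l
  have s1 := h.symm_left
  have s2 := h.symm_right
  fin_cases j <;> fin_cases k <;> fin_cases l <;> simp <;> grind

theorem IsCubicPair.cubicGood_nilpotent [CharZero K] [IsAlgClosed K]
    {F : Fin 3 → Fin 3 → Fin 3 → K} {a : K}
    (h : IsCubicPair F !![a, 0, 1; 0, a, 0; 0, 0, a]) :
    CubicGood F !![a, 0, 1; 0, a, 0; 0, 0, a] := by
  have z : ∀ k l, k ≠ 0 → F 2 k l = 0 := fun k l hk => by
    have := h.symm_mul 0 k l
    have hs := h.symm_left k 0 l
    obtain rfl | rfl | rfl : k = 0 ∨ k = 1 ∨ k = 2 := by fin_cases k <;> simp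
    all_goals simp [Fin.sum_univ_three] at this hs hk <;> rw [hs] at this <;>
        linear_combination this
  convert cubicGood_nilpotent_table a ![F 0 0 0, F 0 0 1, F 0 1 1, F 1 1 1, F 0 0 2] using 1
  funext j k l
  have s1 := h.symm_left
  have s2 := h.symm_right
  fin_cases j <;> fin_cases k <;> fin_cases l <;> simp <;> grind

/-- A non-scalar matrix for which no vector is cyclic differs from a scalar by a matrix of rank
one; a basis puts it in the displayed form. -/
theorem exists_derogatory_form (M : Matrix (Fin 3) (Fin 3) K) (hM : ∀ a : K, M ≠ a • 1)
    (h : ∀ g, (Matrix.of ![g, g ᵥ* M, g ᵥ* M ᵥ* M]).det = 0) :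
    ∃ P Q : Matrix (Fin 3) (Fin 3) K, P * Q = 1 ∧ ∃ c q s,
      Q * M * P = !![0, 1, 0; c * (c - q), q, 0; -(c * s), s, c] := by
  obtain ⟨v, w, hvw⟩ : ∃ v w : Fin 3 → K, (Matrix.of ![v, v ᵥ* M, w]).det ≠ 0 := by
    by_contra! H
    refine hM (M 0 0) ?_
    have a0 := H ![1, 0, 0]
    have a1 := H ![0, 1, 0]
    have a2 := H ![0, 0, 1]
    have a3 := H ![1, 1, 0]
    have a4 := H ![1, 0, 1]
    simp [Matrix.det_fin_three, Matrix.vecMul, dotProduct, Fin.sum_univ_three] at a0 a1 a2 a3 a4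
    have b01 := a0 ![0, 0, 1]
    have b02 := a0 ![0, 1, 0]
    have b10 := a1 ![0, 0, 1]
    have b12 := a1 ![1, 0, 0]
    have b20 := a2 ![0, 1, 0]
    have b21 := a2 ![1, 0, 0]
    have c1 := a3 ![0, 0, 1]
    have c2 := a4 ![0, 1, 0]
    simp at b01 b02 b10 b12 b20 b21 c1 c2
    ext i j
    fin_cases i <;> fin_cases j <;> simp [*] <;> grind
  obtain ⟨Q, hQ⟩ : ∃ Q : Matrix (Fin 3) (Fin 3) K, Q = Matrix.of ![v, v ᵥ* M, w] := ⟨_, rfl⟩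
  rw [← hQ] at hvw
  have hu : IsUnit Q.det := isUnit_iff_ne_zero.mpr hvw
  have hPQ : Q⁻¹ * Q = 1 := Matrix.nonsing_inv_mul _ hu
  have hQP : Q * Q⁻¹ = 1 := Matrix.mul_nonsing_inv _ hu
  refine ⟨Q⁻¹, Q, hPQ, ?_⟩
  obtain ⟨R, hR⟩ : ∃ R, R = Q * M * Q⁻¹ := ⟨_, rfl⟩
  have hRQ : R * Q = Q * M := by rw [hR, Matrix.mul_assoc, hPQ, Matrix.mul_one]
  have hrow : R 0 = ![0, 1, 0] := by
    have e : R 0 ᵥ* Q = ![0, 1, 0] ᵥ* Q := by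
      have e1 : R 0 ᵥ* Q = (R * Q) 0 := rfl
      have e2 : (Q * M) 0 = Q 0 ᵥ* M := rfl
      rw [e1, hRQ, e2, hQ]
      funext k
      simp [Matrix.vecMul, dotProduct, Fin.sum_univ_three]
    have := congrArg (· ᵥ* Q⁻¹) e
    simpa [hQP] using this
  have hdet : ∀ x, (Matrix.of ![x, x ᵥ* R, x ᵥ* R ᵥ* R]).det = 0 := fun x => by
    have e : Matrix.of ![x, x ᵥ* R, x ᵥ* R ᵥ* R] * Q =
        Matrix.of ![x ᵥ* Q, x ᵥ* Q ᵥ* M, x ᵥ* Q ᵥ* M ᵥ* M] := by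
      have e1 : x ᵥ* Q ᵥ* M = x ᵥ* R ᵥ* Q := by
        rw [Matrix.vecMul_vecMul, Matrix.vecMul_vecMul, hRQ]
      have e2 : x ᵥ* Q ᵥ* M ᵥ* M = x ᵥ* R ᵥ* R ᵥ* Q := by
        rw [e1, Matrix.vecMul_vecMul (x ᵥ* R), ← hRQ, ← Matrix.vecMul_vecMul (x ᵥ* R)]
      rw [e2, e1]
      ext i k
      fin_cases i <;> rfl
    have := h (x ᵥ* Q)
    rw [← e, Matrix.det_mul] at this
    exact (mul_eq_zero.mp this).resolve_right hvw
  rw [← hR]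
  have r0 : R 0 0 = 0 := congrFun hrow 0
  have r1 : R 0 1 = 1 := congrFun hrow 1
  have r2 : R 0 2 = 0 := congrFun hrow 2
  have d0 := hdet ![1, 0, 0]
  have d1 := hdet ![-R 2 1, 0, 1]
  have d2 := hdet ![1 - R 2 1, 0, 1]
  simp [Matrix.det_fin_three, Matrix.vecMul, dotProduct, Fin.sum_univ_three, r0, r1, r2,
    -Matrix.vecMul_vecMul] at d0 d1 d2
  have d3 : R 2 0 + R 2 2 * R 2 1 = 0 := by
    rw [← sq_eq_zero_iff (a := R 2 0 + R 2 2 * R 2 1)]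
    linear_combination d1
  refine ⟨R 2 2, R 1 1, R 2 1, ?_⟩
  have d4 : R 1 0 = R 2 2 * (R 2 2 - R 1 1) := by
    rw [d0] at d2
    linear_combination -d2 + (R 2 0 + R 2 2 * R 2 1 + R 1 1 - 2 * R 2 2) * d3
  ext i j
  fin_cases i <;> fin_cases j <;> simp [r0, r1, r2, d0, d4]
  linear_combination d3

theorem IsCubicPair.cubicGood [CharZero K] [IsAlgClosed K] {F : Fin 3 → Fin 3 → Fin 3 → K}
    {M : Matrix (Fin 3) (Fin 3) K} (h : IsCubicPair F M) (hM : ∀ a : K, M ≠ a • 1) :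
    CubicGood F M := by
  by_cases hg : ∃ g, (Matrix.of ![g, g ᵥ* M, g ᵥ* M ᵥ* M]).det ≠ 0
  · obtain ⟨g, hg⟩ := hg
    exact cubicGood_of_cyclic h.symm_left h.symm_right M h.symm_mul rfl g hg
  push Not at hg
  obtain ⟨P, Q, hPQ, c, q, s, hQMP⟩ := exists_derogatory_form M hM hg
  refine CubicGood.change hPQ ?_
  have h' := h.change hPQ
  rw [hQMP] at h' ⊢
  by_cases hq : q = 2 * c
  · have hPQ' : !![1, 0, 0; c, 0, 1; s, 1, 0] * !![1, 0, 0; -s, 0, 1; -c, 1, 0] = 1 := by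
      ext i j
      fin_cases i <;> fin_cases j <;> simp [Matrix.mul_apply, Fin.sum_univ_three]
    have e : !![1, 0, 0; -s, 0, 1; -c, 1, 0] * !![0, 1, 0; c * (c - q), q, 0; -(c * s), s, c] *
        !![1, 0, 0; c, 0, 1; s, 1, 0] = !![c, 0, 1; 0, c, 0; 0, 0, c] := by
      ext i j
      fin_cases i <;> fin_cases j <;> simp [Matrix.mul_apply, Fin.sum_univ_three, hq] <;> ring
    refine CubicGood.change hPQ' ?_
    have h'' := h'.change hPQ'
    rw [e] at h'' ⊢
    exact h''.cubicGood_nilpotent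
  · obtain ⟨T, hT⟩ : ∃ T, T = !![1, 0, 1; c, 0, q - c; 0, 1, s] := ⟨_, rfl⟩
    have hu : IsUnit T.det := by
      refine isUnit_iff_ne_zero.mpr fun h0 => hq ?_
      simp [hT, Matrix.det_fin_three] at h0
      linear_combination -h0
    have e : T⁻¹ * !![0, 1, 0; c * (c - q), q, 0; -(c * s), s, c] * T =
        !![c, 0, 0; 0, c, 0; 0, 0, q - c] := by
      have e1 : !![0, 1, 0; c * (c - q), q, 0; -(c * s), s, c] * T =
          T * !![c, 0, 0; 0, c, 0; 0, 0, q - c] := by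
        rw [hT]
        ext i j
        fin_cases i <;> fin_cases j <;> simp [Matrix.mul_apply, Fin.sum_univ_three] <;> ring
      rw [Matrix.mul_assoc, e1, ← Matrix.mul_assoc, Matrix.nonsing_inv_mul _ hu, Matrix.one_mul]
    have hPQ' := Matrix.mul_nonsing_inv _ hu
    refine CubicGood.change hPQ' ?_
    have h'' := h'.change hPQ'
    rw [e] at h'' ⊢
    exact h''.cubicGood_diag fun hc => hq (by linear_combination -hc)

end CubicClassification

section CubicAlgebra

variable {K : Type*} [Field K]

theorem Good.socle_change {B : Fin 4 → Matrix (Fin 2) (Fin 3) K} {D : Fin 4 → Fin 4 → Fin 3 → K}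
    (h : Good B D) (R : Matrix (Fin 2) (Fin 2) K) (hR : IsUnit R) : Good (fun i => R * B i) D := by
  intro C hC
  let g : Matrix Idx Idx K := Matrix.fromBlocks R 0 0 1
  have hg : IsUnit g := by
    rw [Matrix.isUnit_iff_isUnit_det] at hR ⊢
    simpa [g, Matrix.det_fromBlocks_zero₂₁] using hR
  have hRi : ∀ x, R *ᵥ (R⁻¹ *ᵥ x) = x := fun x => by
    rw [Matrix.mulVec_mulVec, Matrix.mul_nonsing_inv _ ((Matrix.isUnit_iff_isUnit_det _).mp hR),
      Matrix.one_mulVec]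
  refine (h (fun i b => R⁻¹ *ᵥ C i b) fun i j => by rw [hC]).conj g hg fun i => ?_
  ext p q
  rw [Matrix.mul_apply, Matrix.mul_apply]
  simp only [Fintype.sum_sum_type]
  rcases p with j | l | b | o <;> rcases q with j' | l' | b' | o' <;>
    simp [g, tuple1432, blockMat1432, Matrix.one_apply, Matrix.mul_apply]
  · have := congrFun (hRi (C i b')) j
    simp only [Matrix.mulVec, dotProduct, Fin.sum_univ_two] at this
    exact this.symm
  · exact fun h => absurd (Subsingleton.elim _ _) h

theorem exists_dual_vectors {n m : ℕ} (G : (Fin n → K) →ₗ[K] (Fin m → K))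
    (hG : ∀ x, G x = 0 → x = 0) :
    ∃ u : Fin n → Fin m → K, ∀ a x, ∑ i, u a i * G x i = x a := by
  obtain ⟨L, hL⟩ := G.exists_leftInverse_of_injective (LinearMap.ker_eq_bot'.mpr hG)
  refine ⟨fun a => LinearMap.toMatrix' L a, fun a x => ?_⟩
  have e1 : L (G x) = x := LinearMap.congr_fun hL x
  have e2 := congrFun (LinearMap.toMatrix'_mulVec L (G x)) a
  rw [e1] at e2
  exact e2

theorem exists_comb_of_independent {x y z : Fin 3 → K}
    (h : ∀ a b c : K, a • x + b • y + c • z = 0 → a = 0 ∧ b = 0 ∧ c = 0) (q : Fin 3 → K) :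
    ∃ a b c : K, q = a • x + b • y + c • z := by
  have hu : IsUnit (Matrix.of ![x, y, z]) := by
    rw [← Matrix.linearIndependent_rows_iff_isUnit, Fintype.linearIndependent_iff]
    intro g hg
    rw [Fin.sum_univ_three] at hg
    obtain ⟨h0, h1, h2⟩ := h (g 0) (g 1) (g 2) hg
    intro i
    fin_cases i <;> assumption
  obtain ⟨r, hr⟩ := Matrix.vecMul_surjective_iff_isUnit.mpr hu q
  refine ⟨r 0, r 1, r 2, ?_⟩
  rw [← hr]
  funext k
  simp [Matrix.vecMul, dotProduct, Fin.sum_univ_three]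

theorem exists_basis_of_ne_zero {x : Fin 3 → K} (hx : x ≠ 0) :
    ∃ y z : Fin 3 → K, ∀ a b c : K, a • x + b • y + c • z = 0 → a = 0 ∧ b = 0 ∧ c = 0 := by
  obtain ⟨k, hk⟩ := Function.ne_iff.mp hx
  obtain rfl | rfl | rfl : k = 0 ∨ k = 1 ∨ k = 2 := by fin_cases k <;> simp
  · refine ⟨![0, 1, 0], ![0, 0, 1], fun a b c h => ?_⟩
    have h0 := congrFun h 0
    have h1 := congrFun h 1
    have h2 := congrFun h 2
    simp only [Pi.add_apply, Pi.smul_apply, smul_eq_mul, Pi.zero_apply] at h0 h1 h2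
    simp at h0 h1 h2 hk
    simp_all
  · refine ⟨![1, 0, 0], ![0, 0, 1], fun a b c h => ?_⟩
    have h0 := congrFun h 0
    have h1 := congrFun h 1
    have h2 := congrFun h 2
    simp only [Pi.add_apply, Pi.smul_apply, smul_eq_mul, Pi.zero_apply] at h0 h1 h2
    simp at h0 h1 h2 hk
    simp_all
  · refine ⟨![1, 0, 0], ![0, 1, 0], fun a b c h => ?_⟩
    have h0 := congrFun h 0
    have h1 := congrFun h 1
    have h2 := congrFun h 2
    simp only [Pi.add_apply, Pi.smul_apply, smul_eq_mul, Pi.zero_apply] at h0 h1 h2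
    simp at h0 h1 h2 hk
    simp_all

/-- Multiplication maps of an algebra with Hilbert function `(1,4,3,2)` generated in degree one
with socle concentrated in top degree. -/
structure IsCubicAlgebra (B : (Fin 4 → K) →ₗ[K] (Fin 3 → K) →ₗ[K] (Fin 2 → K))
    (D : (Fin 4 → K) →ₗ[K] (Fin 4 → K) →ₗ[K] (Fin 3 → K)) : Prop where
  symm : ∀ v w, D v w = D w v
  assoc : ∀ u v w, B u (D v w) = B v (D u w)
  nondeg : ∀ q, (∀ u, B u q = 0) → q = 0
  spanD : ∀ p : Submodule K (Fin 3 → K), (∀ v w, D v w ∈ p) → p = ⊤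
  spanB : ∀ p : Submodule K (Fin 2 → K), (∀ u q, B u q ∈ p) → p = ⊤

/-- `Good` for multiplication maps in place of their matrices. -/
def GoodMaps (B : (Fin 4 → K) →ₗ[K] (Fin 3 → K) →ₗ[K] (Fin 2 → K))
    (D : (Fin 4 → K) →ₗ[K] (Fin 4 → K) →ₗ[K] (Fin 3 → K)) : Prop :=
  Good (fun i => LinearMap.toMatrix' (B (Pi.single i 1)))
    (fun i b => D (Pi.single i 1) (Pi.single b 1))

theorem Good.goodMaps {B' : Fin 4 → Matrix (Fin 2) (Fin 3) K} {D' : Fin 4 → Fin 4 → Fin 3 → K}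
    (h : Good B' D') {B : (Fin 4 → K) →ₗ[K] (Fin 3 → K) →ₗ[K] (Fin 2 → K)}
    {D : (Fin 4 → K) →ₗ[K] (Fin 4 → K) →ₗ[K] (Fin 3 → K)} (p : Fin 3 → Fin 3 → K)
    (hp : ∀ q, ∃ a b c : K, q = a • p 0 + b • p 1 + c • p 2)
    (hB : ∀ i k, B (Pi.single i 1) (p k) = fun j => B' i j k)
    (hD : ∀ i b, D (Pi.single i 1) (Pi.single b 1) =
      D' i b 0 • p 0 + D' i b 1 • p 1 + D' i b 2 • p 2) : GoodMaps B D := by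
  have hu : IsUnit (Matrix.of p)ᵀ := by
    rw [Matrix.isUnit_transpose, ← Matrix.vecMul_surjective_iff_isUnit]
    intro q
    obtain ⟨a, b, c, rfl⟩ := hp q
    refine ⟨![a, b, c], ?_⟩
    funext k
    simp [Matrix.vecMul, dotProduct, Fin.sum_univ_three]
  refine Good.quadric_change h (Matrix.of p)ᵀ hu (fun i => ?_) fun i b => ?_
  · ext j k
    have e := congrFun (hB i k) j
    rw [← LinearMap.toMatrix'_mulVec] at e
    exact e
  · rw [hD]
    funext k
    simp [Matrix.mulVec, dotProduct, Fin.sum_univ_three]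
    ring

variable {B : (Fin 4 → K) →ₗ[K] (Fin 3 → K) →ₗ[K] (Fin 2 → K)}
  {D : (Fin 4 → K) →ₗ[K] (Fin 4 → K) →ₗ[K] (Fin 3 → K)}

theorem GoodMaps.of_socle_change (R : Matrix (Fin 2) (Fin 2) K) (hR : IsUnit R)
    (h : GoodMaps (B.compr₂ (Matrix.toLin' R)) D) : GoodMaps B D := by
  have hd := (Matrix.isUnit_iff_isUnit_det _).mp hR
  have := Good.socle_change h R⁻¹ (Matrix.isUnit_nonsing_inv_iff.mpr hR)
  unfold GoodMaps
  convert this using 1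
  funext i
  have e : B.compr₂ (Matrix.toLin' R) (Pi.single i 1) =
    (Matrix.toLin' R).comp (B (Pi.single i 1)) := rfl
  rw [e, LinearMap.toMatrix'_comp, LinearMap.toMatrix'_toLin', ← Matrix.mul_assoc,
    Matrix.nonsing_inv_mul _ hd, Matrix.one_mul]

theorem IsCubicAlgebra.socle_change (h : IsCubicAlgebra B D) (R : Matrix (Fin 2) (Fin 2) K)
    (hR : IsUnit R) : IsCubicAlgebra (B.compr₂ (Matrix.toLin' R)) D where
  symm := h.symm
  assoc u v w := by simp [h.assoc u v w]
  nondeg q hq := h.nondeg q fun u => by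
    have := hq u
    exact Matrix.mulVec_injective_iff_isUnit.mpr hR (by simpa using this)
  spanD := h.spanD
  spanB p hp := by
    have := h.spanB (p.comap (Matrix.toLin' R)) fun u q => hp u q
    rw [eq_top_iff]
    intro s _
    obtain ⟨t, rfl⟩ := Matrix.mulVec_surjective_iff_isUnit.mpr hR s
    have ht : t ∈ p.comap (Matrix.toLin' R) := by rw [this]; trivial
    exact ht

theorem IsCubicAlgebra.map_eq_zero (h : IsCubicAlgebra B D) {z : Fin 4 → K}
    (hz : ∀ u w, B u (D z w) = 0) : B z = 0 := by
  have := h.spanD (LinearMap.ker (B z)) fun v w => by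
    rw [LinearMap.mem_ker, h.assoc]
    exact hz v w
  exact LinearMap.ker_eq_top.mp this

theorem IsCubicAlgebra.goodMaps_of_nondeg [CharZero K] [IsAlgClosed K] (h : IsCubicAlgebra B D)
    (hn : ∀ q, (∀ u, B u q 0 = 0) → q = 0) : GoodMaps B D := by
  obtain ⟨u, hu⟩ := exists_dual_vectors (LinearMap.pi fun i : Fin 4 =>
    (LinearMap.proj 0).comp (B (Pi.single i 1))) fun q hq => hn q fun v => by
      rw [pi_eq_sum_univ' v]
      simp only [map_sum, map_smul, LinearMap.sum_apply, LinearMap.smul_apply, Finset.sum_apply,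
        Pi.smul_apply]
      exact Finset.sum_eq_zero fun i _ => by
        have := congrFun hq i
        simp at this
        simp [this]
  have hu : ∀ a q, B (u a) q 0 = q a := fun a q => by
    rw [← hu a q]
    conv_lhs => rw [pi_eq_sum_univ' (u a)]
    simp [Finset.sum_apply]
  obtain ⟨r, hr⟩ : ∃ r : (Fin 4 → K) → (Fin 4 → K),
      r = fun v => v - ∑ k, B v (Pi.single k 1) 0 • u k := ⟨_, rfl⟩
  have r0 : ∀ v q, B (r v) q 0 = 0 := fun v q => by
    rw [hr]
    have e : B v q 0 = ∑ k, q k * B v (Pi.single k 1) 0 := by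
      conv_lhs => rw [pi_eq_sum_univ' q]
      simp
    simp [Fin.sum_univ_three, hu, e]
    ring
  have rD : ∀ v w, D (r v) w = 0 := fun v w => hn _ fun u' => by rw [h.assoc, r0]
  have rB : ∀ v, B (r v) = 0 := fun v => h.map_eq_zero fun u w => by rw [rD, map_zero]
  have eD : ∀ v w, D v w = ∑ k, B v (Pi.single k 1) 0 • D (u k) w := fun v w => by
    have := rD v w
    rw [hr] at this
    simp [Fin.sum_univ_three, sub_eq_zero] at this
    simpa [Fin.sum_univ_three] using this
  have eB : ∀ v, B v = ∑ k, B v (Pi.single k 1) 0 • B (u k) := fun v => by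
    have := rB v
    rw [hr] at this
    simp only [map_sub, map_sum, map_smul, sub_eq_zero] at this
    exact this
  have hpair : IsCubicPair (fun j k l => D (u k) (u l) j)
      (Matrix.of fun k l => B (u k) (Pi.single l 1) 1) := by
    have hM : ∀ j q, ∑ i, B (u j) (Pi.single i 1) 1 * q i = B (u j) q 1 := fun j q => by
      conv_rhs => rw [pi_eq_sum_univ' q]
      simp [mul_comm]
    refine ⟨fun j k l => ?_, fun j k l => ?_, fun j k l => ?_⟩
    · rw [← hu j (D (u k) (u l)), ← hu k (D (u j) (u l)), h.assoc]
    · rw [h.symm]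
    · simp only [Matrix.of_apply]
      rw [hM, hM, h.assoc]
  refine Good.quadric_change (hpair.cubicGood (fun a ha => ?_) fun i k => B (Pi.single i 1)
    (Pi.single k 1) 0) 1 isUnit_one (fun i => ?_) fun i b => ?_
  · have hM : ∀ k l, B (u k) (Pi.single l 1) 1 = a * B (u k) (Pi.single l 1) 0 := fun k l => by
      have := congrFun (congrFun ha k) l
      rw [hu]
      simpa [Matrix.one_apply, Pi.single_apply] using this
    have := h.spanB
      (LinearMap.ker ((LinearMap.proj 1 : (Fin 2 → K) →ₗ[K] K) - a • LinearMap.proj 0))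
      fun v q => by
        rw [eB, pi_eq_sum_univ' q]
        simp [Fin.sum_univ_three, hM]
        ring
    have h1 : (![0, 1] : Fin 2 → K) ∈
        LinearMap.ker ((LinearMap.proj 1 : (Fin 2 → K) →ₗ[K] K) - a • LinearMap.proj 0) := by
      rw [this]
      trivial
    simp at h1
  · rw [Matrix.mul_one]
    ext j k
    rw [LinearMap.toMatrix'_apply]
    fin_cases j
    · simp
    · conv_lhs => rw [eB]
      simp [Matrix.vecMul, dotProduct, Fin.sum_univ_three]
  · rw [Matrix.one_mulVec]
    funext j
    rw [eD, Finset.sum_apply]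
    refine Finset.sum_congr rfl fun k _ => ?_
    rw [h.symm, eD, Pi.smul_apply, Finset.sum_apply, Finset.smul_sum]
    refine Finset.sum_congr rfl fun l _ => ?_
    rw [h.symm, Pi.smul_apply, smul_eq_mul, smul_eq_mul, mul_assoc]

end CubicAlgebra

section DegenerateCubicAlgebra

variable {K : Type*} [Field K]

/-- The algebras generated in degree one by two elements. -/
theorem good_pencil [CharZero K] [IsAlgClosed K] (ξ ψ : Fin 4 → K) (e : Fin 4 → Fin 2 → K) :
    Good (fun i => Matrix.of fun j k => ξ i * e k.castSucc j + ψ i * e k.succ j)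
      (fun i b => ![ξ i * ξ b, ξ i * ψ b + ψ i * ξ b, ψ i * ψ b]) := by
  have : Infinite K := inferInstance
  refine Good.of_generic (σ := Fin 4 × Fin 2)
    (B := fun x i => Matrix.of fun j k => ξ i * x (k.castSucc, j) + ψ i * x (k.succ, j))
    (D := fun _ i b => ![ξ i * ξ b, ξ i * ψ b + ψ i * ξ b, ψ i * ψ b])
    (fun i j k => ?_) (fun _ _ _ => PolyFun.const _)
    (fun x => x (1, 0) * x (0, 1) - x (1, 1) * x (0, 0)) (by fun_prop)
    (fun p => ![![0, 1], ![1, 0], ![0, 0], ![0, 0]] p.1 p.2) (by simp) (fun x hx => ?_)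
    fun p => e p.1 p.2
  · simp only [Matrix.of_apply]
    fun_prop
  · obtain ⟨r, s, hrs⟩ := exists_comb_of_det₂_ne_zero (x := fun j => x (1, j))
      (y := fun j => x (0, j)) hx fun j => x (3, j)
    convert good_of_closure (closure_of_single !![0, 0, s; 1, 0, r; 0, 1, 0] ξ ψ fun _ => 0)
      ![1, 0, 0] (Matrix.of fun j (k : Fin 3) => x (k.castSucc, j)) using 1
    · funext i
      ext j k
      have := hrs j
      fin_cases k <;> simp [Matrix.mul_apply, Fin.sum_univ_three, Matrix.one_apply] <;> grind
    · funext i b k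
      fin_cases k <;>
        simp [Matrix.mulVec, dotProduct, Matrix.mul_apply, Fin.sum_univ_three, Matrix.one_apply]
      ring

/-- The multiplication by three linear forms, squares and products of the last two being zero. -/
theorem good_square_zero [CharZero K] [IsAlgClosed K] (ξ ψ θ : Fin 4 → K) (a b c : Fin 2 → K) :
    Good (fun i => Matrix.of fun j k =>
        ![ξ i * a j + ψ i * b j + θ i * c j, ξ i * b j, ξ i * c j] k)
      (fun i b => ![ξ i * ξ b, ξ i * ψ b + ψ i * ξ b, ξ i * θ b + θ i * ξ b]) := by
  convert good_of_closure (closure_of_square_zero ξ ψ θ) ![1, 0, 0]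
    (Matrix.of fun j => ![a j, b j, c j]) using 1
  · funext i
    ext j k
    fin_cases k <;> simp [Matrix.mul_apply, Fin.sum_univ_three] <;> ring
  · funext i b k
    fin_cases k <;>
      simp [Matrix.mulVec, dotProduct, Matrix.mul_apply, Fin.sum_univ_three] <;> ring

variable {B : (Fin 4 → K) →ₗ[K] (Fin 3 → K) →ₗ[K] (Fin 2 → K)}
  {D : (Fin 4 → K) →ₗ[K] (Fin 4 → K) →ₗ[K] (Fin 3 → K)}

theorem IsCubicAlgebra.goodMaps_of_two_generators [CharZero K] [IsAlgClosed K]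
    (h : IsCubicAlgebra B D) (x y : Fin 4 → K)
    (hV : ∀ v, ∃ ξ ψ : K, ∃ z, v = ξ • x + ψ • y + z ∧ ∀ w, D z w = 0) : GoodMaps B D := by
  choose ξ ψ z hv hD using hV
  have hB : ∀ v, B (z v) = 0 := fun v => h.map_eq_zero fun u w => by rw [hD, map_zero]
  have eD : ∀ v w, D v w = (ξ v * ξ w) • D x x + (ξ v * ψ w + ψ v * ξ w) • D x y +
      (ψ v * ψ w) • D y y := fun v w => by
    have hD' : ∀ u v, D u (z v) = 0 := fun u v => by rw [h.symm, hD]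
    conv_lhs => rw [hv v, hv w]
    simp only [map_add, map_smul, LinearMap.add_apply, LinearMap.smul_apply, hD, hD', h.symm y x]
    module
  have eB : ∀ v, B v = ξ v • B x + ψ v • B y := fun v => by
    conv_lhs => rw [hv v]
    simp only [map_add, map_smul, hB, add_zero]
  have hspan := h.spanD (Submodule.span K {D x x, D x y, D y y}) fun v w => by
    rw [Submodule.mem_span_triple]
    exact ⟨_, _, _, (eD v w).symm⟩
  refine (good_pencil (fun i => ξ (Pi.single i 1)) (fun i => ψ (Pi.single i 1))
    ![B x (D x x), B x (D x y), B x (D y y), B y (D y y)]).goodMaps ![D x x, D x y, D y y]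
    (fun q => ?_) (fun i k => ?_) fun i b => ?_
  · have : q ∈ Submodule.span K {D x x, D x y, D y y} := by
      rw [hspan]
      trivial
    obtain ⟨a, b, c, hq⟩ := Submodule.mem_span_triple.mp this
    exact ⟨a, b, c, hq.symm⟩
  · rw [eB]
    have e1 : B y (D x x) = B x (D x y) := by rw [h.assoc y x x, h.symm y x]
    have e2 : B y (D x y) = B x (D y y) := h.assoc y x y
    funext j
    fin_cases k <;> simp [e1, e2]
  · rw [eD]
    rfl

theorem IsCubicAlgebra.goodMaps_of_isotropic [CharZero K] [IsAlgClosed K]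
    (h : IsCubicAlgebra B D) {x y z : Fin 4 → K} {q₀ p p' : Fin 3 → K}
    (hV : ∀ v, ∃ ξ ψ θ : K, ∃ w, v = ξ • x + ψ • y + θ • z + w ∧ ∀ u, D w u = 0)
    (hzx : D z x = q₀) (hzy : D z y = 0) (hzz : D z z = 0)
    (h0 : ∀ u, B u q₀ 0 = 0) (hz : ∀ q, B z q 0 = 0) (hx1 : B x q₀ 1 = 1) (hy1 : B y q₀ 1 = 0)
    (hz1 : B z q₀ 1 = 0)
    (hp0 : p ≠ 0) (hp : ∀ u, B u p 1 = 0) (hp0' : p' ≠ 0) (hp' : ∀ u, B u p' 0 + B u p' 1 = 0) :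
    GoodMaps B D := by
  choose ξ ψ θ k hv hD using hV
  have hB : ∀ v, B (k v) = 0 := fun v => h.map_eq_zero fun u w => by rw [hD, map_zero]
  have eD : ∀ v w, D v w = (ξ v * ξ w) • D x x + (ξ v * ψ w + ψ v * ξ w) • D x y +
      (ψ v * ψ w) • D y y + (ξ v * θ w + θ v * ξ w) • q₀ := fun v w => by
    have hD' : ∀ u v, D u (k v) = 0 := fun u v => by rw [h.symm, hD]
    conv_lhs => rw [hv v, hv w]
    simp only [map_add, map_smul, LinearMap.add_apply, LinearMap.smul_apply, hD, hD', h.symm y x,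
      h.symm x z, h.symm y z, hzx, hzy, hzz]
    module
  have eB : ∀ v, B v = ξ v • B x + ψ v • B y + θ v • B z := fun v => by
    conv_lhs => rw [hv v]
    simp only [map_add, map_smul, hB, add_zero]
  obtain ⟨e, hxq⟩ : ∃ e, B x q₀ = e := ⟨_, rfl⟩
  have he : e 1 = 1 := by rw [← hxq, hx1]
  have hyq : B y q₀ = 0 := by
    ext j
    fin_cases j <;> simp [h0, hy1]
  have hzq : B z q₀ = 0 := by
    ext j
    fin_cases j <;> simp [h0, hz1]
  have hza : B z (D x x) = e := by rw [h.assoc, hzx, hxq]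
  have hzb : B z (D x y) = 0 := by rw [h.assoc, hzy, map_zero]
  have hzc : B z (D y y) = 0 := by rw [h.assoc, hzy, map_zero]
  have hbasis : ∀ a b c : K, a • D x x + b • p + c • q₀ = 0 → a = 0 ∧ b = 0 ∧ c = 0 := by
    intro a b c habc
    have e1 := congrFun (congrArg (B z) habc) 1
    simp [hza, hzq, hp, he] at e1
    have e2 := congrFun (congrArg (B x) habc) 1
    simp [e1, hxq, hp, he] at e2
    subst e1 e2
    simp [hp0] at habc
    exact ⟨rfl, habc, rfl⟩
  have hspan := exists_comb_of_independent hbasis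
  have hker : ∀ q, B z q 1 = 0 → ∃ b c : K, q = b • p + c • q₀ := fun q hq => by
    obtain ⟨a, b, c, rfl⟩ := hspan q
    simp [hza, hzq, hp, he] at hq
    exact ⟨b, c, by simp [hq]⟩
  have hyp : B y p = 0 := by
    obtain ⟨s, r, hsr⟩ := hker p' (by simpa [hz] using hp' z)
    have e1 := hp' x
    have e2 := hp' y
    simp [hsr, hp, h0, hx1, hy1] at e1 e2
    have e3 : s ≠ 0 := by
      rintro rfl
      simp at e1
      simp [e1] at hsr
      exact hp0' hsr
    ext j
    fin_cases j
    · simpa [e3] using e2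
    · simpa using hp y
  have hker' : ∀ q, B z q = 0 → B y q = 0 := fun q hq => by
    obtain ⟨b, c, rfl⟩ := hker q (by rw [hq]; rfl)
    simp [hyp, hyq]
  have hyb := hker' _ hzb
  have hyc := hker' _ hzc
  have hxc : B x (D y y) = 0 := by rw [h.assoc, hyb]
  have hc : D y y = 0 := h.nondeg _ fun u => by
    rw [eB]
    simp [hxc, hyc, hzc]
  have hspan' := h.spanD (Submodule.span K {D x x, D x y, q₀}) fun v w => by
    rw [Submodule.mem_span_triple]
    exact ⟨_, _, _, by rw [eD v w, hc, smul_zero, add_zero]⟩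
  refine (good_square_zero (fun i => ξ (Pi.single i 1)) (fun i => ψ (Pi.single i 1))
    (fun i => θ (Pi.single i 1)) (B x (D x x)) (B x (D x y)) e).goodMaps ![D x x, D x y, q₀]
    (fun q => ?_) (fun i k => ?_) fun i b => ?_
  · have : q ∈ Submodule.span K {D x x, D x y, q₀} := by
      rw [hspan']
      trivial
    obtain ⟨a, b, c, hq⟩ := Submodule.mem_span_triple.mp this
    exact ⟨a, b, c, hq.symm⟩
  · rw [eB]
    have e1 : B y (D x x) = B x (D x y) := by rw [h.assoc y x x, h.symm y x]
    funext j
    fin_cases k <;> simp [e1, hza, hzb, hyb, hxq, hyq, hzq]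
  · rw [eD, hc, smul_zero, add_zero]
    rfl

end DegenerateCubicAlgebra

section Classification

variable {K : Type*} [Field K] {B : (Fin 4 → K) →ₗ[K] (Fin 3 → K) →ₗ[K] (Fin 2 → K)}
  {D : (Fin 4 → K) →ₗ[K] (Fin 4 → K) →ₗ[K] (Fin 3 → K)}

theorem IsCubicAlgebra.goodMaps_of_unique [CharZero K] [IsAlgClosed K] (h : IsCubicAlgebra B D)
    {q₀ : Fin 3 → K} (hq₀ : q₀ ≠ 0) (h0 : ∀ u, B u q₀ 0 = 0)
    (huniq : ∀ q, (∀ u, B u q 0 = 0) → ∃ r : K, q = r • q₀)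
    (hinf : ∃ p ≠ 0, ∀ u, B u p 1 = 0)
    (hfin : ∀ t : K, ∃ p ≠ 0, ∀ u, B u p 0 + t * B u p 1 = 0) : GoodMaps B D := by
  obtain ⟨q₁, q₂, hbasis⟩ := exists_basis_of_ne_zero hq₀
  have hspan := exists_comb_of_independent hbasis
  obtain ⟨u, hu⟩ := exists_dual_vectors (n := 2) (LinearMap.pi fun i : Fin 4 =>
    ((LinearMap.proj 0).comp (B (Pi.single i 1))).comp
      ((LinearMap.proj 0).smulRight q₁ + (LinearMap.proj 1).smulRight q₂)) fun x hx => by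
    obtain ⟨r, hr⟩ := huniq (x 0 • q₁ + x 1 • q₂) fun v => by
      rw [pi_eq_sum_univ' v]
      simp only [map_sum, map_smul, LinearMap.sum_apply, LinearMap.smul_apply, Finset.sum_apply,
        Pi.smul_apply]
      exact Finset.sum_eq_zero fun i _ => by
        have := congrFun hx i
        simp at this
        simp [this]
    obtain ⟨-, e1, e2⟩ := hbasis (-r) (x 0) (x 1) (by rw [add_assoc, hr]; module)
    funext i
    fin_cases i
    exacts [e1, e2]
  have hu : ∀ a (x : Fin 2 → K), B (u a) (x 0 • q₁ + x 1 • q₂) 0 = x a := fun a x => by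
    rw [← hu a x]
    conv_lhs => rw [pi_eq_sum_univ' (u a)]
    simp [Finset.sum_apply, mul_add]
  have u01 : B (u 0) q₁ 0 = 1 := by simpa using hu 0 ![1, 0]
  have u02 : B (u 0) q₂ 0 = 0 := by simpa using hu 0 ![0, 1]
  have u11 : B (u 1) q₁ 0 = 0 := by simpa using hu 1 ![1, 0]
  have u12 : B (u 1) q₂ 0 = 1 := by simpa using hu 1 ![0, 1]
  have hdecomp : ∀ v, ∃ a b : K, ∃ z, v = a • u 0 + b • u 1 + z ∧ ∀ q, B z q 0 = 0 := fun v => by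
    refine ⟨B v q₁ 0, B v q₂ 0, v - (B v q₁ 0 • u 0 + B v q₂ 0 • u 1), by module, fun q => ?_⟩
    obtain ⟨a, b, c, rfl⟩ := hspan q
    simp [h0, u01, u02, u11, u12]
    ring
  -- the value of `B z` at `q₀` vanishes for `z` in the kernel of the first component
  have hη : ∀ z, (∀ q, B z q 0 = 0) → B z q₀ 1 = 0 := fun z hz => by
    by_contra hne
    have hdet : ∀ t : K, t ≠ 0 → (Matrix.of ![![B z q₀ 1, B z q₁ 1, B z q₂ 1],
        ![t * B (u 0) q₀ 1, 1 + t * B (u 0) q₁ 1, t * B (u 0) q₂ 1],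
        ![t * B (u 1) q₀ 1, t * B (u 1) q₁ 1, 1 + t * B (u 1) q₂ 1]]).det = 0 := fun t ht => by
      obtain ⟨p, hp, hpt⟩ := hfin t
      obtain ⟨a, b, c, rfl⟩ := hspan p
      refine Matrix.exists_mulVec_eq_zero_iff.mp ⟨![a, b, c], ?_, ?_⟩
      · intro h
        have h0 := congrFun h 0
        have h1 := congrFun h 1
        have h2 := congrFun h 2
        simp at h0 h1 h2
        simp [h0, h1, h2] at hp
      · have e0 := hpt z
        have e1 := hpt (u 0)
        have e2 := hpt (u 1)
        simp [h0, hz, ht, u01, u02, u11, u12] at e0 e1 e2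
        funext i
        fin_cases i <;> simp [Matrix.mulVec, dotProduct, Fin.sum_univ_three]
        · linear_combination e0
        · linear_combination e1
        · linear_combination e2
    have d1 := hdet 1 one_ne_zero
    have d2 := hdet (-1) (neg_ne_zero.mpr one_ne_zero)
    have d3 := hdet 2 two_ne_zero
    simp [Matrix.det_fin_three] at d1 d2 d3
    have : 6 * B z q₀ 1 = 0 := by linear_combination 6 * d1 + 2 * d2 - 2 * d3
    simp at this
    exact hne this
  have hDz : ∀ z, (∀ q, B z q 0 = 0) → ∀ w, ∃ r : K, D z w = r • q₀ := fun z hz w =>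
    huniq _ fun v => by rw [h.assoc, hz]
  obtain ⟨x, y, hx, hy, hV⟩ : ∃ x y, B x q₀ 1 = 1 ∧ B y q₀ 1 = 0 ∧
      ∀ v, ∃ a b : K, ∃ z, v = a • x + b • y + z ∧ ∀ q, B z q 0 = 0 := by
    have hne : B (u 0) q₀ 1 ≠ 0 ∨ B (u 1) q₀ 1 ≠ 0 := by
      by_contra! hcon
      refine hq₀ (h.nondeg _ fun v => ?_)
      obtain ⟨a, b, z, rfl, hz⟩ := hdecomp v
      funext j
      fin_cases j
      · exact h0 _
      · simp [hcon, hη z hz]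
    obtain ⟨α, β, hαβ⟩ : ∃ α β : K, α * B (u 0) q₀ 1 + β * B (u 1) q₀ 1 = 1 := by
      rcases hne with hne | hne
      · exact ⟨(B (u 0) q₀ 1)⁻¹, 0, by simp [hne]⟩
      · exact ⟨0, (B (u 1) q₀ 1)⁻¹, by simp [hne]⟩
    refine ⟨α • u 0 + β • u 1, B (u 1) q₀ 1 • u 0 - B (u 0) q₀ 1 • u 1, by simpa using hαβ,
      by simp [mul_comm], fun v => ?_⟩
    obtain ⟨a, b, z, rfl, hz⟩ := hdecomp v
    refine ⟨a * B (u 0) q₀ 1 + b * B (u 1) q₀ 1, a * β - b * α, z, ?_, hz⟩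
    generalize B (u 0) q₀ 1 = m at *
    generalize B (u 1) q₀ 1 = n at *
    congr 1
    rw [← one_smul K (a • u 0 + b • u 1), ← hαβ]
    module
  -- products with `z` in the kernel of the first component factor through evaluation at `q₀`
  have hD : ∀ z, (∀ q, B z q 0 = 0) → ∀ w, D z w = B w q₀ 1 • D z x := fun z hz w => by
    obtain ⟨r, hr⟩ := hDz z hz w
    obtain ⟨s, hs⟩ := hDz z hz x
    have e1 := congrFun (h.assoc x z w) 1
    have e2 := congrFun (h.assoc w z x) 1
    rw [h.symm w x, ← e1, hr, hs] at e2
    simp [hx] at e2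
    rw [hr, hs, smul_smul, ← e2, mul_comm]
  by_cases hθ : ∀ z, (∀ q, B z q 0 = 0) → D z x = 0
  · refine h.goodMaps_of_two_generators x y fun v => ?_
    obtain ⟨a, b, z, hv, hz⟩ := hV v
    exact ⟨a, b, z, hv, fun w => by rw [hD z hz, hθ z hz, smul_zero]⟩
  · push Not at hθ
    obtain ⟨z, hz, hzx⟩ := hθ
    obtain ⟨r, hr⟩ := hDz z hz x
    have hr0 : r ≠ 0 := by
      rintro rfl
      exact hzx (by rw [hr, zero_smul])
    have hz' : ∀ q, B (r⁻¹ • z) q 0 = 0 := fun q => by simp [hz]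
    have hzx' : D (r⁻¹ • z) x = q₀ := by simp [hr, hr0]
    obtain ⟨p, hp0, hp⟩ := hinf
    obtain ⟨p', hp0', hp'⟩ := hfin 1
    refine h.goodMaps_of_isotropic (x := x) (y := y) (fun v => ?_) hzx'
      (by rw [hD _ hz', hy, zero_smul])
      (by rw [hD _ hz', hη _ hz', zero_smul]) h0 hz' hx hy (hη _ hz') hp0 hp hp0'
      (fun u => by simpa using hp' u)
    obtain ⟨a, b, w, rfl, hw⟩ := hV v
    obtain ⟨s, hs⟩ := hDz w hw x
    refine ⟨a, b, s, w - s • r⁻¹ • z, by module, fun u => ?_⟩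
    rw [hD _ (fun q => by simp [hw, hz])]
    rw [map_sub, map_smul, LinearMap.sub_apply, LinearMap.smul_apply, hzx', hs, sub_self, smul_zero]

theorem exists_eq_smul_of_finrank_le_one (p : Submodule K (Fin 3 → K))
    (hp : Module.finrank K p ≤ 1) {q₀ : Fin 3 → K} (hq₀ : q₀ ≠ 0) (h₀ : q₀ ∈ p) (q : Fin 3 → K)
    (hq : q ∈ p) : ∃ r : K, q = r • q₀ := by
  obtain ⟨v, hv⟩ := finrank_le_one_iff.mp hp
  obtain ⟨a, ha⟩ := hv ⟨q₀, h₀⟩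
  obtain ⟨b, hb⟩ := hv ⟨q, hq⟩
  have ha' : a • (v : Fin 3 → K) = q₀ := congrArg Subtype.val ha
  have hb' : b • (v : Fin 3 → K) = q := congrArg Subtype.val hb
  have : a ≠ 0 := by
    rintro rfl
    exact hq₀ (by rw [← ha', zero_smul])
  exact ⟨b * a⁻¹, by rw [← ha', ← hb', smul_smul, inv_mul_cancel_right₀ this]⟩

theorem IsCubicAlgebra.goodMaps [CharZero K] [IsAlgClosed K] (h : IsCubicAlgebra B D) :
    GoodMaps B D := by
  by_cases H : ∀ R : Matrix (Fin 2) (Fin 2) K, R.det ≠ 0 → ∃ q ≠ 0, ∀ u, (R *ᵥ B u q) 0 = 0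
  · have h0 : ∃ p ≠ 0, ∀ u, B u p 0 = 0 := by simpa using H 1 (by simp)
    have h1 : ∃ p ≠ 0, ∀ u, B u p 1 = 0 := by
      simpa [Matrix.mulVec, dotProduct] using H !![0, 1; 1, 0] (by simp [Matrix.det_fin_two])
    have h0t : ∀ t : K, ∃ p ≠ 0, ∀ u, B u p 0 + t * B u p 1 = 0 := fun t => by
      simpa [Matrix.mulVec, dotProduct] using H !![1, t; 0, 1] (by simp [Matrix.det_fin_two])
    have h1t : ∀ t : K, ∃ p ≠ 0, ∀ u, B u p 1 + t * B u p 0 = 0 := fun t => by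
      simpa [Matrix.mulVec, dotProduct, add_comm] using
        H !![t, 1; 1, 0] (by simp [Matrix.det_fin_two])
    obtain ⟨N, hN⟩ : ∃ N : Fin 2 → Submodule K (Fin 3 → K), ∀ j q, q ∈ N j ↔ ∀ u, B u q j = 0 :=
      ⟨fun j => ⨅ u, LinearMap.ker ((LinearMap.proj j).comp (B u)), fun j q => by simp⟩
    have hdisj : Disjoint (N 0) (N 1) := by
      rw [Submodule.disjoint_def]
      intro q hq0 hq1
      refine h.nondeg q fun u => ?_
      funext j
      fin_cases j
      exacts [(hN 0 q).mp hq0 u, (hN 1 q).mp hq1 u]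
    have hrank := Submodule.finrank_add_finrank_le_of_disjoint hdisj
    rw [Module.finrank_fin_fun] at hrank
    obtain ⟨p0, hp0, e0⟩ := h0
    obtain ⟨p1, hp1, e1⟩ := h1
    rcases (by lia : Module.finrank K (N 0) ≤ 1 ∨ Module.finrank K (N 1) ≤ 1) with hr | hr
    · exact h.goodMaps_of_unique hp0 e0 (fun q hq => exists_eq_smul_of_finrank_le_one _ hr hp0
        ((hN 0 p0).mpr e0) q ((hN 0 q).mpr hq)) ⟨p1, hp1, e1⟩ h0t
    · have hR : IsUnit !![0, 1; (1 : K), 0] := by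
        rw [Matrix.isUnit_iff_isUnit_det]
        simp [Matrix.det_fin_two]
      refine GoodMaps.of_socle_change _ hR ((h.socle_change _ hR).goodMaps_of_unique hp1
        (fun u => ?_) (fun q hq => exists_eq_smul_of_finrank_le_one _ hr hp1
          ((hN 1 p1).mpr e1) q ((hN 1 q).mpr fun u => ?_)) ⟨p0, hp0, fun u => ?_⟩ fun t => ?_)
      · simpa [Matrix.mulVec, dotProduct] using e1 u
      · simpa [Matrix.mulVec, dotProduct] using hq u
      · simpa [Matrix.mulVec, dotProduct] using e0 u
      · simpa [Matrix.mulVec, dotProduct] using h1t t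
  · push Not at H
    obtain ⟨R, hdet, hR⟩ := H
    have hR' : IsUnit R := (Matrix.isUnit_iff_isUnit_det _).mpr (isUnit_iff_ne_zero.mpr hdet)
    refine GoodMaps.of_socle_change R hR' ((h.socle_change R hR').goodMaps_of_nondeg fun q hq => ?_)
    by_contra hne
    obtain ⟨u, hu⟩ := hR q hne
    exact hu (hq u)

end Classification

section Reduction

variable {K : Type*} [Field K]

theorem isCubicAlgebra_of_matrices {B : Fin 4 → Matrix (Fin 2) (Fin 3) K}
    {D : Fin 4 → Matrix (Fin 3) (Fin 4) K} {f : Fin 4 → (Fin 4 → K)}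
    (hDf : ∀ i j, D i *ᵥ f j = D j *ᵥ f i) (hBD : ∀ i j, B i * D j = B j * D i)
    (hq : ∀ q, (∀ i, B i *ᵥ q = 0) → q = 0) (hf : ∀ x, ∃ w : Fin 4 → K, x = ∑ i, w i • f i)
    (hD : (⨆ i, LinearMap.range (Matrix.mulVecLin (D i))) = ⊤)
    (hB : (⨆ i, LinearMap.range (Matrix.mulVecLin (B i))) = ⊤) :
    IsCubicAlgebra (Fintype.linearCombination K fun i => Matrix.toLin' (B i))
      (Fintype.linearCombination K fun i =>
        Matrix.toLin' (D i) ∘ₗ Fintype.linearCombination K f) where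
  symm v w := by
    simp only [Fintype.linearCombination_apply, LinearMap.sum_apply, LinearMap.smul_apply,
      LinearMap.comp_apply, map_sum, map_smul, Matrix.toLin'_apply, Finset.smul_sum]
    rw [Finset.sum_comm]
    exact Finset.sum_congr rfl fun i _ => Finset.sum_congr rfl fun j _ => by
      rw [hDf, smul_comm]
  assoc u v w := by
    simp only [Fintype.linearCombination_apply, LinearMap.sum_apply, LinearMap.smul_apply,
      LinearMap.comp_apply, Matrix.toLin'_apply]
    generalize ∑ i, w i • f i = x
    simp only [Matrix.mulVec_sum, Matrix.mulVec_smul, Finset.smul_sum, Matrix.mulVec_mulVec]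
    rw [Finset.sum_comm]
    exact Finset.sum_congr rfl fun i _ => Finset.sum_congr rfl fun j _ => by
      rw [hBD, smul_comm]
  nondeg q h := hq q fun i => by
    simpa [Fintype.linearCombination_apply_single] using h (Pi.single i 1)
  spanD p hp := by
    rw [eq_top_iff, ← hD]
    refine iSup_le fun i => ?_
    rintro _ ⟨x, rfl⟩
    obtain ⟨w, rfl⟩ := hf x
    simpa [Fintype.linearCombination_apply_single, Fintype.linearCombination_apply] using
      hp (Pi.single i 1) w
  spanB p hp := by
    rw [eq_top_iff, ← hB]
    refine iSup_le fun i => ?_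
    rintro _ ⟨x, rfl⟩
    simpa [Fintype.linearCombination_apply_single] using hp (Pi.single i 1) x

theorem blockMat1432_mulVec_inl (B : Matrix (Fin 2) (Fin 3) K) (C : Matrix (Fin 2) (Fin 4) K)
    (D : Matrix (Fin 3) (Fin 4) K) (f : Fin 4 → K) (s : Fin 2 → K) (q : Fin 3 → K) :
    blockMat1432 B C D f *ᵥ Sum.elim s (Sum.elim q 0) = Sum.elim (B *ᵥ q) 0 := by
  funext x
  rcases x with a | a | a | a <;>
    simp [blockMat1432, Matrix.mulVec, dotProduct]

/-- If the common kernel is two-dimensional, no nonzero vector of the second block is killed by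
all `B i`. -/
theorem eq_zero_of_finrank_ker_eq_two {B : Fin 4 → Matrix (Fin 2) (Fin 3) K}
    {C : Fin 4 → Matrix (Fin 2) (Fin 4) K} {D : Fin 4 → Matrix (Fin 3) (Fin 4) K}
    {f : Fin 4 → (Fin 4 → K)}
    (hker : Module.finrank K ↥(⨅ i, LinearMap.ker
      (Matrix.mulVecLin (blockMat1432 (B i) (C i) (D i) (f i)))) = 2)
    (q : Fin 3 → K) (hq : ∀ i, B i *ᵥ q = 0) : q = 0 := by
  obtain ⟨S, hS⟩ : ∃ S : (Fin 2 → K) →ₗ[K] (Fin 2 ⊕ (Fin 3 ⊕ (Fin 4 ⊕ Fin 1)) → K),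
      ∀ s, S s = Sum.elim s (Sum.elim 0 0) :=
    ⟨LinearMap.pi (Sum.elim (fun a => LinearMap.proj a) 0), fun s => by
      funext x
      rcases x with a | a | a <;> simp⟩
  have hinj : Function.Injective S := fun s t h => by
    rw [hS, hS] at h
    funext a
    exact congrFun h (Sum.inl a)
  have hle : LinearMap.range S ≤ ⨅ i, LinearMap.ker
      (Matrix.mulVecLin (blockMat1432 (B i) (C i) (D i) (f i))) := by
    rintro _ ⟨s, rfl⟩
    rw [Submodule.mem_iInf]
    intro i
    rw [LinearMap.mem_ker, Matrix.mulVecLin_apply, hS, blockMat1432_mulVec_inl, Matrix.mulVec_zero]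
    simp
  have heq := Submodule.eq_of_le_of_finrank_eq hle (by
    rw [hker, LinearMap.finrank_range_of_inj hinj, Module.finrank_fin_fun])
  have hmem : (Sum.elim 0 (Sum.elim q 0) : Fin 2 ⊕ (Fin 3 ⊕ (Fin 4 ⊕ Fin 1)) → K) ∈
      LinearMap.range S := by
    rw [heq, Submodule.mem_iInf]
    intro i
    rw [LinearMap.mem_ker, Matrix.mulVecLin_apply, blockMat1432_mulVec_inl, hq]
    simp
  obtain ⟨s, hs⟩ := hmem
  rw [hS] at hs
  funext a
  exact (congrFun hs (Sum.inr (Sum.inl a))).symm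

/-- The block matrix determined by `B, C, D, f` becomes the one attached to structure constants
in the basis `f` of the third block. -/
theorem InSimDiagClosure.of_tuple1432 {B : Fin 4 → Matrix (Fin 2) (Fin 3) K}
    {C : Fin 4 → Matrix (Fin 2) (Fin 4) K} {D : Fin 4 → Matrix (Fin 3) (Fin 4) K}
    {f : Fin 4 → (Fin 4 → K)} (hf : IsUnit (Matrix.of f))
    (h : InSimDiagClosure (tuple1432 B (fun i b => C i *ᵥ f b) fun i b => D i *ᵥ f b)) :
    InSimDiagClosure fun i => blockMat1432 (B i) (C i) (D i) (f i) := by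
  refine h.conj (Matrix.fromBlocks 1 0 0 (Matrix.fromBlocks 1 0 0
    (Matrix.fromBlocks (Matrix.of f)ᵀ 0 0 1))) ?_ fun i => ?_
  · rw [Matrix.isUnit_iff_isUnit_det] at hf ⊢
    simpa [Matrix.det_fromBlocks_zero₂₁] using hf
  · ext x y
    rcases x with a | a | a | a <;> rcases y with b | b | b | b <;>
      simp [tuple1432, blockMat1432, Matrix.mul_apply, Matrix.mulVec, dotProduct, Matrix.one_apply,
        Pi.single_apply]
    exact fun hb => absurd (Subsingleton.elim b 0) hb

end Reduction

/-- **Proposition 5.7 (HF:1432), socle dimension 2 part.** Every local algebra with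
Hilbert function (1,4,3,2) and socle dimension 2 is smoothable, in matrix form. -/
theorem stmt18 {K : Type*} [Field K] [CharZero K] [IsAlgClosed K]
    (B : Fin 4 → Matrix (Fin 2) (Fin 3) K) (C : Fin 4 → Matrix (Fin 2) (Fin 4) K)
    (D : Fin 4 → Matrix (Fin 3) (Fin 4) K) (f : Fin 4 → (Fin 4 → K))
    (A : Fin 4 → Matrix (Fin 2 ⊕ (Fin 3 ⊕ (Fin 4 ⊕ Fin 1))) (Fin 2 ⊕ (Fin 3 ⊕ (Fin 4 ⊕ Fin 1))) K)
    (hA : A = fun i => blockMat1432 (B i) (C i) (D i) (f i))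
    (hcomm : ∀ i j, A i * A j = A j * A i)
    (hf : LinearIndependent K f)
    (hD : (⨆ i, LinearMap.range (Matrix.mulVecLin (D i))) = ⊤)
    (hB : (⨆ i, LinearMap.range (Matrix.mulVecLin (B i))) = ⊤)
    (hker : Module.finrank K ↥(⨅ i, LinearMap.ker (Matrix.mulVecLin (A i))) = 2) :
    InSimDiagClosure A := by
  subst hA
  have hfu : IsUnit (Matrix.of f) := Matrix.linearIndependent_rows_iff_isUnit.mp hf
  have hfs : ∀ x, ∃ w : Fin 4 → K, x = ∑ i, w i • f i := fun x => by
    obtain ⟨w, hw⟩ := Matrix.vecMul_surjective_iff_isUnit.mpr hfu x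
    exact ⟨w, hw.symm.trans (Matrix.vecMul_eq_sum _ _)⟩
  have hDf : ∀ i j, D i *ᵥ f j = D j *ᵥ f i := fun i j => by
    funext a
    simpa [blockMat1432, Matrix.mul_apply, Matrix.mulVec, dotProduct] using
      congrFun (congrFun (hcomm i j) (Sum.inr (Sum.inl a))) (Sum.inr (Sum.inr (Sum.inr 0)))
  have hCf : ∀ i j, C i *ᵥ f j = C j *ᵥ f i := fun i j => by
    funext a
    simpa [blockMat1432, Matrix.mul_apply, Matrix.mulVec, dotProduct] using
      congrFun (congrFun (hcomm i j) (Sum.inl a)) (Sum.inr (Sum.inr (Sum.inr 0)))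
  have hBD : ∀ i j, B i * D j = B j * D i := fun i j => by
    ext a b
    simpa [blockMat1432, Matrix.mul_apply] using
      congrFun (congrFun (hcomm i j) (Sum.inl a)) (Sum.inr (Sum.inr (Sum.inl b)))
  have hgood := (isCubicAlgebra_of_matrices hDf hBD (eq_zero_of_finrank_ker_eq_two hker) hfs
    hD hB).goodMaps
  refine InSimDiagClosure.of_tuple1432 hfu ?_
  simpa [Fintype.linearCombination_apply_single] using hgood (fun i b => C i *ᵥ f b) hCf
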